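/- Self-duality of cuspidal representations distinguished by the linear subgroup: Let 𝒌 be a finite field with q elements, q odd, of characteristic p, and R an algebraically closed field of characteristic different from p. Let n = 2m, and let H = {diag(g1,g2) : g1,g2 ∈ GL_m(𝒌)} ⊆ GL_{2m}(𝒌). If (π,V) is an irreducible cuspidal R-representation of GL_{2m}(𝒌) which is H-distinguished (there exists a nonzero linear form Λ : V → R with Λ∘π(h) = Λ for all h ∈ H), then π is self-dual: π ≅ π^∨. -/

import Mathlib

open Matrix
noncomputable section

namespace Stmt19

variable {k R V : Type*} [Field k] [Fintype k] [DecidableEq k] [Field R]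
  [AddCommGroup V] [Module R V] {m : ℕ}

/-- The block diagonal element `diag(g₁, g₂)` of `GL_{2m}(𝒌)` attached to
`g₁, g₂ ∈ GL_m(𝒌)`. -/
def blockDiagGL (g₁ g₂ : GL (Fin m) k) : GL (Fin m ⊕ Fin m) k :=
  ⟨Matrix.fromBlocks ↑g₁ 0 0 ↑g₂, Matrix.fromBlocks ↑(g₁⁻¹) 0 0 ↑(g₂⁻¹),
    by rw [Matrix.fromBlocks_multiply]
       simp only [mul_zero, zero_mul, add_zero, zero_add, ← Units.val_mul,
         mul_inv_cancel, inv_mul_cancel, Units.val_one, Matrix.fromBlocks_one],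
    by rw [Matrix.fromBlocks_multiply]
       simp only [mul_zero, zero_mul, add_zero, zero_add, ← Units.val_mul,
         mul_inv_cancel, inv_mul_cancel, Units.val_one, Matrix.fromBlocks_one]⟩

/-- `u` lies in the unipotent radical of the parabolic subgroup determined by the block
function `b`. -/
def UnipCond {ι : Type*} [Fintype ι] [DecidableEq ι] {N : ℕ} (b : ι → Fin N)
    (u : GL ι k) : Prop :=
  (∀ i j, b j < b i → (u : Matrix ι ι k) i j = 0) ∧
  (∀ i j, b i = b j → (u : Matrix ι ι k) i j = if i = j then 1 else 0)

/-- Cuspidality: for the unipotent radical of every proper parabolic subgroup (a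
conjugate of the block unipotent subgroup attached to a non-constant block function),
the coinvariants vanish. -/
def IsCuspidal {ι : Type*} [Fintype ι] [DecidableEq ι]
    (π : Representation R (GL ι k) V) : Prop :=
  ∀ (N : ℕ) (b : ι → Fin N), (∃ i j, b i ≠ b j) → ∀ h : GL ι k,
    Submodule.span R {x : V | ∃ u : GL ι k, UnipCond b u ∧
      ∃ v : V, x = v - π (h * u * h⁻¹) v} = ⊤

section MatrixCoefficients

variable {G V₁ V₂ : Type*} [Group G] [AddCommGroup V₁] [Module R V₁] [AddCommGroup V₂]
  [Module R V₂]

/-- The linear map sending a vector to its matrix coefficient against the linear form `l`. -/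
def matrixCoeff (π : Representation R G V) (l : Module.Dual R V) : V →ₗ[R] (G → R) :=
  LinearMap.pi fun g => l ∘ₗ π g

lemma matrixCoeff_apply (π : Representation R G V) (l : Module.Dual R V) (v : V) (g : G) :
    matrixCoeff π l v g = l (π g v) := rfl

lemma matrixCoeff_injective {π : Representation R G V} {l : Module.Dual R V}
    (hl : ∀ v, (∀ g, l (π g v) = 0) → v = 0) : Function.Injective (matrixCoeff π l) := by
  rw [injective_iff_map_eq_zero]
  exact fun v hv => hl v fun g => congrFun hv g

lemma range_matrixCoeff {π : Representation R G V} {w : V}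
    (hw : Submodule.span R (Set.range fun g => π g w) = ⊤) (l : Module.Dual R V) :
    LinearMap.range (matrixCoeff π l) =
      Submodule.span R (Set.range fun x : G => fun g : G => l (π (g * x) w)) := by
  rw [LinearMap.range_eq_map, ← hw, Submodule.map_span, ← Set.range_comp]
  congr 2
  ext x g
  simp [matrixCoeff_apply]

/-- Two representations with a common nonzero matrix coefficient, attached to generating vectors
and cogenerating linear forms, are isomorphic. -/
lemma exists_equiv_of_coeff_eq (π₁ : Representation R G V₁) (π₂ : Representation R G V₂)
    {w₁ : V₁} {w₂ : V₂} {l₁ : Module.Dual R V₁} {l₂ : Module.Dual R V₂}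
    (hw₁ : Submodule.span R (Set.range fun g => π₁ g w₁) = ⊤)
    (hw₂ : Submodule.span R (Set.range fun g => π₂ g w₂) = ⊤)
    (hl₁ : ∀ v, (∀ g, l₁ (π₁ g v) = 0) → v = 0)
    (hl₂ : ∀ v, (∀ g, l₂ (π₂ g v) = 0) → v = 0)
    (h : ∀ g, l₁ (π₁ g w₁) = l₂ (π₂ g w₂)) :
    ∃ e : V₁ ≃ₗ[R] V₂, ∀ g v, e (π₁ g v) = π₂ g (e v) := by
  have hr : LinearMap.range (matrixCoeff π₁ l₁) = LinearMap.range (matrixCoeff π₂ l₂) := by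
    simp only [range_matrixCoeff hw₁, range_matrixCoeff hw₂, h]
  have i₁ := matrixCoeff_injective hl₁
  have i₂ := matrixCoeff_injective hl₂
  let e : V₁ ≃ₗ[R] V₂ := (LinearEquiv.ofInjective _ i₁).trans
    ((LinearEquiv.ofEq _ _ hr).trans (LinearEquiv.ofInjective _ i₂).symm)
  have he : ∀ v, matrixCoeff π₂ l₂ (e v) = matrixCoeff π₁ l₁ v := fun v => by
    have : LinearEquiv.ofInjective _ i₂ (e v) =
        LinearEquiv.ofEq _ _ hr (LinearEquiv.ofInjective _ i₁ v) := by
      simp [e]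
    simpa using congrArg Subtype.val this
  refine ⟨e, fun g v => i₂ ?_⟩
  rw [he]
  ext x
  have := congrFun (he v) (x * g)
  simp only [matrixCoeff_apply, map_mul, Module.End.mul_apply] at this ⊢
  exact this.symm

end MatrixCoefficients

section Irreducible

variable {G : Type*} [Group G] {π : Representation R G V}

lemma span_orbit_eq_top
    (hirr : ∀ W : Submodule R V, (∀ g, ∀ v ∈ W, π g v ∈ W) → W = ⊥ ∨ W = ⊤)
    {w : V} (hw : w ≠ 0) : Submodule.span R (Set.range fun g => π g w) = ⊤ := by
  refine (hirr _ fun g v hv => ?_).resolve_left fun h => hw ?_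
  · induction hv using Submodule.span_induction with
    | mem x hx =>
      obtain ⟨g', rfl⟩ := hx
      exact Submodule.subset_span ⟨g * g', by simp⟩
    | zero => simp
    | add x y _ _ hx hy => rw [map_add]; exact add_mem hx hy
    | smul a x _ hx => rw [map_smul]; exact Submodule.smul_mem _ _ hx
  · have : w ∈ Submodule.span R (Set.range fun g => π g w) :=
      Submodule.subset_span ⟨1, by simp⟩
    simpa [h] using this

lemma eq_zero_of_forall_coeff_eq_zero
    (hirr : ∀ W : Submodule R V, (∀ g, ∀ v ∈ W, π g v ∈ W) → W = ⊥ ∨ W = ⊤)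
    {l : Module.Dual R V} (hl : l ≠ 0) (v : V) (hv : ∀ g, l (π g v) = 0) : v = 0 := by
  by_contra hne
  refine hl (LinearMap.ext fun x => ?_)
  have hx : x ∈ Submodule.span R (Set.range fun g => π g v) := by
    rw [span_orbit_eq_top hirr hne]; trivial
  have hle : Submodule.span R (Set.range fun g => π g v) ≤ LinearMap.ker l := by
    rw [Submodule.span_le]
    rintro _ ⟨g, rfl⟩
    exact hv g
  exact hle hx

lemma span_dual_orbit_eq_top [FiniteDimensional R V]
    (hirr : ∀ W : Submodule R V, (∀ g, ∀ v ∈ W, π g v ∈ W) → W = ⊥ ∨ W = ⊤)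
    {l : Module.Dual R V} (hl : l ≠ 0) :
    Submodule.span R (Set.range fun g => π.dual g l) = ⊤ := by
  have hbot : (Submodule.span R (Set.range fun g => π.dual g l)).dualCoannihilator = ⊥ := by
    rw [eq_bot_iff]
    intro v hv
    rw [Submodule.mem_dualCoannihilator] at hv
    refine eq_zero_of_forall_coeff_eq_zero hirr hl v fun g => ?_
    have := hv _ (Submodule.subset_span ⟨g⁻¹, rfl⟩)
    simpa [Representation.dual_apply, Module.Dual.transpose_apply] using this
  rw [← Subspace.dualCoannihilator_dualAnnihilator_eq (W := Submodule.span R _), hbot,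
    Submodule.dualAnnihilator_bot]

end Irreducible

section Averaging

variable {G : Type*} [Group G]

/-- The (unnormalised) projector onto the `χ`-eigenspace of a finite subgroup. -/
def eigenProj (π : Representation R G V) (Q : Subgroup G) [Fintype Q] (χ : G → R) :
    V →ₗ[R] V :=
  ∑ u : Q, χ (u : G)⁻¹ • π u

lemma eigenProj_apply (π : Representation R G V) (Q : Subgroup G) [Fintype Q] (χ : G → R)
    (v : V) : eigenProj π Q χ v = ∑ u : Q, χ (u : G)⁻¹ • π u v := by
  simp [eigenProj]

lemma map_eigenProj (π : Representation R G V) (Q : Subgroup G) [Fintype Q] {χ : G → R}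
    (h1 : χ 1 = 1) (hχ : ∀ x ∈ Q, ∀ y ∈ Q, χ (x * y) = χ x * χ y) {x : G} (hx : x ∈ Q) (v : V) :
    π x (eigenProj π Q χ v) = χ x • eigenProj π Q χ v := by
  rw [eigenProj_apply, map_sum, Finset.smul_sum]
  refine Fintype.sum_equiv (Equiv.mulLeft (⟨x, hx⟩ : Q)) _ _ fun u => ?_
  have hxx : χ x * χ x⁻¹ = 1 := by rw [← hχ x hx _ (inv_mem hx), mul_inv_cancel, h1]
  simp only [Equiv.coe_mulLeft, Subgroup.coe_mul, _root_.mul_inv_rev, map_smul, map_mul,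
    Module.End.mul_apply, smul_smul]
  rw [hχ _ (inv_mem u.2) _ (inv_mem hx), mul_left_comm, hxx, mul_one]

lemma eigenProj_map (π : Representation R G V) (Q : Subgroup G) [Fintype Q] {χ : G → R}
    (h1 : χ 1 = 1) (hχ : ∀ x ∈ Q, ∀ y ∈ Q, χ (x * y) = χ x * χ y) {x : G} (hx : x ∈ Q) (v : V) :
    eigenProj π Q χ (π x v) = χ x • eigenProj π Q χ v := by
  rw [eigenProj_apply, eigenProj_apply, Finset.smul_sum]
  refine Fintype.sum_equiv (Equiv.mulRight (⟨x, hx⟩ : Q)) _ _ fun u => ?_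
  have hxx : χ x * χ x⁻¹ = 1 := by rw [← hχ x hx _ (inv_mem hx), mul_inv_cancel, h1]
  simp only [Equiv.coe_mulRight, Subgroup.coe_mul, _root_.mul_inv_rev, map_mul,
    Module.End.mul_apply, smul_smul]
  rw [hχ _ (inv_mem hx) _ (inv_mem u.2), ← mul_assoc, hxx, one_mul]

lemma eigenProj_of_eigenvector (π : Representation R G V) (Q : Subgroup G) [Fintype Q]
    {χ : G → R} (h1 : χ 1 = 1) (hχ : ∀ x ∈ Q, ∀ y ∈ Q, χ (x * y) = χ x * χ y) {w : V}
    (hw : ∀ u ∈ Q, π u w = χ u • w) : eigenProj π Q χ w = (Fintype.card Q : R) • w := by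
  rw [eigenProj_apply, Finset.sum_congr rfl fun (u : Q) _ => ?_, Finset.sum_const,
    Finset.card_univ, ← Nat.cast_smul_eq_nsmul R]
  rw [hw u u.2, smul_smul, ← hχ _ (inv_mem u.2) _ u.2, inv_mul_cancel, h1, one_smul]

/-- If the coinvariants of a subgroup of invertible order vanish, so do its invariants. -/
lemma eq_zero_of_invariant_of_coinvariants (π : Representation R G V) (Q : Subgroup G)
    [Fintype Q] (hQ : (Fintype.card Q : R) ≠ 0)
    (hspan : Submodule.span R {x : V | ∃ u ∈ Q, ∃ v : V, x = v - π u v} = ⊤) {w : V}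
    (hw : ∀ u ∈ Q, π u w = w) : w = 0 := by
  have hχ : ∀ x ∈ Q, ∀ y ∈ Q, (fun _ : G => (1 : R)) (x * y) = 1 * 1 := by simp
  have hle : Submodule.span R {x : V | ∃ u ∈ Q, ∃ v : V, x = v - π u v} ≤
      LinearMap.ker (eigenProj π Q fun _ => 1) := by
    rw [Submodule.span_le]
    rintro _ ⟨u, hu, v, rfl⟩
    simp [eigenProj_map π Q (χ := fun _ => 1) rfl hχ hu]
  rw [hspan] at hle
  have h0 : eigenProj π Q (fun _ => 1) w = 0 := hle trivial
  rw [eigenProj_of_eigenvector π Q (χ := fun _ => 1) rfl hχ (by simpa using hw)] at h0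
  exact (smul_eq_zero.1 h0).resolve_left hQ

end Averaging

section Unipotent

variable {F : Type*} [Field F] {n : ℕ}

/-- `M` is upper unitriangular, with columns of index `< c` those of the identity. -/
structure IsUnitri (c : ℕ) (M : Matrix (Fin n) (Fin n) F) : Prop where
  lower : ∀ i j, j < i → M i j = 0
  diag : ∀ i, M i i = 1
  left : ∀ i j : Fin n, (j : ℕ) < c → i < j → M i j = 0

lemma IsUnitri.det {c : ℕ} {M : Matrix (Fin n) (Fin n) F} (h : IsUnitri c M) : M.det = 1 := by
  rw [det_of_isUpperTriangular fun i j hij => h.lower i j hij]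
  simp [h.diag]

lemma IsUnitri.eq_zero {c : ℕ} {M : Matrix (Fin n) (Fin n) F} (h : IsUnitri c M) {i j : Fin n}
    (hij : i ≠ j) (hj : j < i ∨ (j : ℕ) < c) : M i j = 0 := by
  rcases lt_or_gt_of_ne hij with hlt | hlt
  · exact hj.elim (fun hj => absurd hj hlt.asymm) fun hj => h.left i j hj hlt
  · exact h.lower i j hlt

lemma isUnitri_one (c : ℕ) : IsUnitri c (1 : Matrix (Fin n) (Fin n) F) :=
  ⟨fun _ _ h => one_apply_ne h.ne', fun _ => one_apply_eq _, fun _ _ _ h => one_apply_ne h.ne⟩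

lemma IsUnitri.mul_apply {c : ℕ} {M N : Matrix (Fin n) (Fin n) F} (hM : IsUnitri c M)
    (hN : IsUnitri c N) {i j : Fin n} (hij : i < j)
    (h : ∀ l : Fin n, i < l → l < j → M i l = 0 ∨ N l j = 0) :
    (M * N) i j = M i j + N i j := by
  rw [Matrix.mul_apply, ← Finset.sum_subset (Finset.subset_univ {i, j}), Finset.sum_pair hij.ne,
    hM.diag, hN.diag, one_mul, mul_one, add_comm]
  intro l _ hl
  simp only [Finset.mem_insert, Finset.mem_singleton, not_or] at hl
  rcases lt_or_gt_of_ne hl.1 with h1 | h1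
  · rw [hM.lower _ _ h1, zero_mul]
  rcases lt_or_gt_of_ne hl.2 with h2 | h2
  · rcases h l h1 h2 with h | h <;> simp [h]
  · rw [hN.lower _ _ h2, mul_zero]

lemma IsUnitri.mul {c : ℕ} {M N : Matrix (Fin n) (Fin n) F} (hM : IsUnitri c M)
    (hN : IsUnitri c N) : IsUnitri c (M * N) where
  lower i j hij := by
    rw [Matrix.mul_apply]
    refine Finset.sum_eq_zero fun l _ => ?_
    rcases lt_or_ge l i with h | h
    · rw [hM.lower _ _ h, zero_mul]
    · rw [hN.lower _ _ (hij.trans_le h), mul_zero]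
  diag i := by
    rw [Matrix.mul_apply, Finset.sum_eq_single i, hM.diag, hN.diag, one_mul]
    · intro l _ hl
      rcases lt_or_gt_of_ne hl with h | h
      · rw [hM.lower _ _ h, zero_mul]
      · rw [hN.lower _ _ h, mul_zero]
    · simp
  left i j hj hij := by
    rw [hM.mul_apply hN hij, hM.left i j hj hij, hN.left i j hj hij, add_zero]
    exact fun l _ h2 => Or.inr (hN.left _ _ hj h2)

/-- A submonoid of a finite group, as a subgroup. -/
def subgroupOfFinite {G : Type*} [Group G] [Finite G] (S : Submonoid G) : Subgroup G :=
  { S with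
    inv_mem' := fun {x} hx => by
      have h : x⁻¹ ∈ Submonoid.powers x := by
        rw [← SetLike.mem_coe, powers_eq_zpowers]
        exact inv_mem (Subgroup.mem_zpowers x)
      exact (Submonoid.powers_le (P := S)).2 hx h }

/-- The group of upper unitriangular matrices whose columns of index `< c` are trivial. -/
def unitri (F : Type*) [Field F] [Finite F] (n c : ℕ) : Subgroup (GL (Fin n) F) :=
  subgroupOfFinite
    { carrier := {g | IsUnitri c (g : Matrix (Fin n) (Fin n) F)}
      mul_mem' := fun {a b} ha hb => by
        exact IsUnitri.mul (M := (a : Matrix (Fin n) (Fin n) F)) ha hb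
      one_mem' := isUnitri_one c }

/-- The unipotent radical of the standard maximal parabolic subgroup of type `(c, n - c)`. -/
def unipRadical (F : Type*) [Field F] [Finite F] (n c : ℕ) : Subgroup (GL (Fin n) F) :=
  subgroupOfFinite
    { carrier := {g | IsUnitri c (g : Matrix (Fin n) (Fin n) F) ∧
        ∀ i j : Fin n, c ≤ i → i < j → (g : Matrix (Fin n) (Fin n) F) i j = 0}
      mul_mem' := fun {a b} ha hb => by
        refine ⟨IsUnitri.mul (M := (a : Matrix (Fin n) (Fin n) F)) ha.1 hb.1,
          fun i j hi hij => ?_⟩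
        rw [GeneralLinearGroup.coe_mul, ha.1.mul_apply hb.1 hij fun l hl _ => .inl (ha.2 i l hi hl),
          ha.2 i j hi hij, hb.2 i j hi hij, add_zero]
      one_mem' := ⟨isUnitri_one c, fun _ _ _ h => one_apply_ne h.ne⟩ }

lemma mem_unipRadical [Finite F] {c : ℕ} {g : GL (Fin n) F} :
    g ∈ unipRadical F n c ↔ IsUnitri c (g : Matrix (Fin n) (Fin n) F) ∧
      ∀ i j : Fin n, c ≤ i → i < j → (g : Matrix (Fin n) (Fin n) F) i j = 0 := Iff.rfl

lemma mem_unitri [Finite F] {c : ℕ} {g : GL (Fin n) F} :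
    g ∈ unitri F n c ↔ IsUnitri c (g : Matrix (Fin n) (Fin n) F) := Iff.rfl

/-- An upper unitriangular matrix as an element of the general linear group. -/
def IsUnitri.toGL {c : ℕ} {M : Matrix (Fin n) (Fin n) F} (h : IsUnitri c M) : GL (Fin n) F :=
  GeneralLinearGroup.mkOfDetNeZero M (by rw [h.det]; exact one_ne_zero)

lemma IsUnitri.coe_toGL {c : ℕ} {M : Matrix (Fin n) (Fin n) F} (h : IsUnitri c M) :
    (h.toGL : Matrix (Fin n) (Fin n) F) = M := rfl

lemma IsUnitri.toGL_mem [Finite F] {c : ℕ} {M : Matrix (Fin n) (Fin n) F} (h : IsUnitri c M) :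
    h.toGL ∈ unitri F n c := h

lemma isPGroup_unitri [Finite F] (c : ℕ) : IsPGroup (ringChar F) (unitri F n c) := by
  rintro ⟨g, hg⟩
  have : Fact (ringChar F).Prime := ⟨CharP.char_is_prime F _⟩
  have hg' : IsUnitri c (g : Matrix (Fin n) (Fin n) F) := hg
  have hpow : ((g : Matrix (Fin n) (Fin n) F) - 1) ^ n = 0 := by
    have h := aeval_self_charpoly (g : Matrix (Fin n) (Fin n) F)
    rw [charpoly_of_isUpperTriangular _ fun i j hij => hg'.lower i j hij] at h
    simpa [hg'.diag] using h
  refine ⟨n, Subtype.ext (Units.ext ?_)⟩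
  have : CharP (Matrix (Fin n) (Fin n) F) (ringChar F) ∨ n = 0 := by
    rcases Nat.eq_zero_or_pos n with h | h
    · exact Or.inr h
    · have : Nonempty (Fin n) := ⟨⟨0, h⟩⟩
      exact Or.inl inferInstance
  rcases this with _ | rfl
  · have h : ((g : Matrix (Fin n) (Fin n) F) - 1) ^ ringChar F ^ n = 0 := by
      have hle : n ≤ ringChar F ^ n :=
        (Nat.lt_pow_self (CharP.char_is_prime F (ringChar F)).one_lt).le
      rw [← Nat.add_sub_cancel' hle, pow_add, hpow, zero_mul]
    rw [sub_pow_char_pow_of_commute _ _ (Commute.one_right _), one_pow, sub_eq_zero] at h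
    simpa using h
  · exact Subsingleton.elim _ _

lemma card_ne_zero_of_isPGroup [Finite F] {Q : Type*} [Group Q] [Fintype Q]
    (hQ : IsPGroup (ringChar F) Q) (hchar : ringChar R ≠ ringChar F) :
    (Fintype.card Q : R) ≠ 0 := by
  have : Fact (ringChar F).Prime := ⟨CharP.char_is_prime F _⟩
  obtain ⟨m, hm⟩ := IsPGroup.iff_card.1 hQ
  rw [← Nat.card_eq_fintype_card, hm, Nat.cast_pow]
  refine pow_ne_zero _ fun h => ?_
  rcases (Nat.dvd_prime this.out).1 ((ringChar.spec R _).1 h) with h1 | h1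
  · exact CharP.ringChar_ne_one h1
  · exact hchar h1

end Unipotent

section Bruhat

variable {F : Type*} [Field F] {n : ℕ}

/-- The matrix with entry `c j` at position `(w j, j)` and zeros elsewhere. -/
def monomialMatrix (w : Equiv.Perm (Fin n)) (c : Fin n → F) : Matrix (Fin n) (Fin n) F :=
  of fun i j => if i = w j then c j else 0

lemma monomialMatrix_apply (w : Equiv.Perm (Fin n)) (c : Fin n → F) (i j : Fin n) :
    monomialMatrix w c i j = if i = w j then c j else 0 := rfl

lemma monomialMatrix_mul_apply (w : Equiv.Perm (Fin n)) (c : Fin n → F)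
    (M : Matrix (Fin n) (Fin n) F) (i j : Fin n) :
    (monomialMatrix w c * M) (w i) j = c i * M i j := by
  rw [Matrix.mul_apply, Finset.sum_eq_single i]
  · simp [monomialMatrix_apply]
  · intro l _ hl
    simp [monomialMatrix_apply, hl.symm]
  · simp

lemma mul_monomialMatrix_apply (w : Equiv.Perm (Fin n)) (c : Fin n → F)
    (M : Matrix (Fin n) (Fin n) F) (i j : Fin n) :
    (M * monomialMatrix w c) i j = M i (w j) * c j := by
  rw [Matrix.mul_apply, Finset.sum_eq_single (w j)]
  · simp [monomialMatrix_apply]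
  · intro l _ hl
    simp [monomialMatrix_apply, hl]
  · simp

lemma isUnitri_one_add_vecMulVec_left {x : Fin n → F} {i : Fin n} (hx : ∀ r, i ≤ r → x r = 0) :
    IsUnitri 0 (1 + vecMulVec x (Pi.single i 1)) where
  lower r j hj := by
    rw [Matrix.add_apply, one_apply_ne hj.ne', vecMulVec_apply, zero_add]
    by_cases h : j = i
    · rw [hx r (h ▸ hj.le), zero_mul]
    · rw [Pi.single_eq_of_ne h, mul_zero]
  diag r := by
    rw [Matrix.add_apply, one_apply_eq, vecMulVec_apply]
    by_cases h : r = i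
    · rw [hx r h.ge, zero_mul, add_zero]
    · rw [Pi.single_eq_of_ne h, mul_zero, add_zero]
  left _ _ h := by simp at h

lemma isUnitri_one_add_vecMulVec_right {y : Fin n → F} {s : Fin n} (hy : ∀ r, r ≤ s → y r = 0) :
    IsUnitri 0 (1 + vecMulVec (Pi.single s 1) y) where
  lower r j hj := by
    rw [Matrix.add_apply, one_apply_ne hj.ne', vecMulVec_apply, zero_add]
    by_cases h : r = s
    · rw [hy j (h ▸ hj.le), mul_zero]
    · rw [Pi.single_eq_of_ne h, zero_mul]
  diag r := by
    rw [Matrix.add_apply, one_apply_eq, vecMulVec_apply]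
    by_cases h : r = s
    · rw [hy r h.le, mul_zero, add_zero]
    · rw [Pi.single_eq_of_ne h, zero_mul, add_zero]
  left _ _ h := by simp at h

lemma one_add_vecMulVec_mul_apply (x : Fin n → F) (i : Fin n) (M : Matrix (Fin n) (Fin n) F)
    (a b : Fin n) : ((1 + vecMulVec x (Pi.single i 1)) * M) a b = M a b + x a * M i b := by
  rw [add_mul, one_mul, vecMulVec_mul, Matrix.add_apply, vecMulVec_apply, single_one_vecMul]
  rfl

lemma mul_one_add_vecMulVec_apply (y : Fin n → F) (s : Fin n) (M : Matrix (Fin n) (Fin n) F)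
    (a b : Fin n) : (M * (1 + vecMulVec (Pi.single s 1) y)) a b = M a b + M a s * y b := by
  rw [mul_add, mul_one, mul_vecMulVec, Matrix.add_apply, vecMulVec_apply, mulVec_single_one]
  rfl

variable [Finite F]

/-- Gaussian elimination by upper unitriangular matrices, applied to the first `s` columns. -/
lemma exists_pivots (g : GL (Fin n) F) (s : ℕ) (hs : s ≤ n) :
    ∃ u₁ ∈ unitri F n 0, ∃ u₂ ∈ unitri F n 0, ∀ j : Fin n, (j : ℕ) < s → ∃ r : Fin n,
      (u₁ * g * u₂ : GL (Fin n) F) r j ≠ 0 ∧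
      (∀ i, i ≠ r → (u₁ * g * u₂ : GL (Fin n) F) i j = 0) ∧
      ∀ j', j' ≠ j → (u₁ * g * u₂ : GL (Fin n) F) r j' = 0 := by
  induction s with
  | zero => exact ⟨1, one_mem _, 1, one_mem _, fun j hj => absurd hj (Nat.not_lt_zero _)⟩
  | succ s ih =>
    obtain ⟨u₁, hu₁, u₂, hu₂, h⟩ := ih (by omega)
    set M := u₁ * g * u₂ with hM
    let t : Fin n := ⟨s, hs⟩
    have hcol : ∃ i, M i t ≠ 0 := by
      by_contra! h0
      exact M.det_ne_zero (det_eq_zero_of_column_eq_zero t h0)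
    obtain ⟨i, hi, hmax⟩ := Set.exists_max_image {i | M i t ≠ 0} id (Set.toFinite _) hcol
    have hmax' : ∀ r, i < r → M r t = 0 := fun r hr => by
      by_contra h0
      exact absurd (hmax r h0) (not_le.2 hr)
    have hMi : ∀ j : Fin n, (j : ℕ) < s → M i j = 0 := fun j hj => by
      obtain ⟨r, -, h2, h3⟩ := h j hj
      refine h2 i fun hir => hi ?_
      rw [hir]
      exact h3 t (Fin.ne_of_gt hj)
    let x : Fin n → F := fun r => if r < i then -(M r t / M i t) else 0
    let y : Fin n → F := fun b => if t < b then -(M i b / M i t) else 0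
    have hx : ∀ r, i ≤ r → x r = 0 := fun r hr => if_neg (not_lt.2 hr)
    have hy : ∀ r, r ≤ t → y r = 0 := fun r hr => if_neg (not_lt.2 hr)
    have hX := isUnitri_one_add_vecMulVec_left hx
    have hY := isUnitri_one_add_vecMulVec_right hy
    refine ⟨hX.toGL * u₁, mul_mem hX.toGL_mem hu₁, u₂ * hY.toGL, mul_mem hu₂ hY.toGL_mem, ?_⟩
    have hM' : ∀ a b, (hX.toGL * u₁ * g * (u₂ * hY.toGL) : GL (Fin n) F) a b =
        M a b + x a * M i b + (M a t + x a * M i t) * y b := fun a b => by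
      have : hX.toGL * u₁ * g * (u₂ * hY.toGL) = hX.toGL * M * hY.toGL := by
        simp only [hM, mul_assoc]
      rw [this, GeneralLinearGroup.coe_mul, hY.coe_toGL, mul_one_add_vecMulVec_apply,
        GeneralLinearGroup.coe_mul, hX.coe_toGL, one_add_vecMulVec_mul_apply,
        one_add_vecMulVec_mul_apply]
    have hcolt : ∀ a, a ≠ i → M a t + x a * M i t = 0 := fun a ha => by
      rcases lt_or_gt_of_ne ha with h1 | h1
      · have : x a = -(M a t / M i t) := if_pos h1
        rw [this, neg_mul, div_mul_cancel₀ _ hi, add_neg_cancel]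
      · rw [hmax' a h1, hx a h1.le, zero_mul, add_zero]
    simp only [hM']
    intro j hj
    rcases Nat.lt_succ_iff_lt_or_eq.1 hj with hj | hj
    · obtain ⟨r, h1, h2, h3⟩ := h j hj
      have hyj : y j = 0 := hy j (Fin.le_def.2 hj.le)
      have hrt : M r t = 0 := h3 t (Fin.ne_of_gt hj)
      have hxr : x r = 0 := by simp [x, hrt]
      refine ⟨r, ?_, fun a ha => ?_, fun b hb => ?_⟩
      · simpa [hyj, hxr] using h1
      · simp [hyj, hMi j hj, h2 a ha]
      · simp [hrt, hxr, h3 b hb]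
    · obtain rfl : j = t := Fin.ext hj
      refine ⟨i, ?_, fun a ha => ?_, fun b hb => ?_⟩
      · simpa [hx i le_rfl, hy t le_rfl] using hi
      · rw [hcolt a ha, zero_mul, add_zero]
      · rw [hx i le_rfl]
        rcases lt_or_gt_of_ne hb with h1 | h1
        · rw [hMi b h1, hy b h1.le]; simp
        · have : y b = -(M i b / M i t) := if_pos h1
          have hi' : M i t ≠ 0 := hi
          rw [this, zero_mul, add_zero, zero_mul, add_zero, mul_neg, mul_div_cancel₀ _ hi',
            add_neg_cancel]

/-- The Bruhat decomposition: every double coset of the upper unitriangular group contains a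
monomial matrix. -/
lemma exists_unitri_mul_mul_eq_monomialMatrix (g : GL (Fin n) F) :
    ∃ u₁ ∈ unitri F n 0, ∃ u₂ ∈ unitri F n 0, ∃ (w : Equiv.Perm (Fin n)) (c : Fin n → F),
      (∀ i, c i ≠ 0) ∧ ((u₁ * g * u₂ : GL (Fin n) F) : Matrix (Fin n) (Fin n) F) =
        monomialMatrix w c := by
  obtain ⟨u₁, hu₁, u₂, hu₂, h⟩ := exists_pivots g n le_rfl
  choose r h1 h2 h3 using fun j => h j j.2
  have hr : Function.Injective r := fun a b hab => by
    by_contra hne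
    exact h1 b (hab ▸ h3 a b (Ne.symm hne))
  refine ⟨u₁, hu₁, u₂, hu₂, Equiv.ofBijective r (Finite.injective_iff_bijective.1 hr),
    fun j => (u₁ * g * u₂ : GL (Fin n) F) (r j) j, h1, ?_⟩
  ext i j
  rw [monomialMatrix_apply, Equiv.ofBijective_apply]
  split_ifs with hij
  · rw [hij]
  · exact h2 j i hij

end Bruhat

section Permutation

variable {n : ℕ}

/-- A permutation of an interval all of whose descents are by exactly one is an involution
(it reverses consecutive blocks), and it preserves any function constant along descents. -/
lemma apply_apply_eq_of_descents {α : Type*} (v : Equiv.Perm (Fin n)) (f : Fin n → α)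
    (h : ∀ i j : Fin n, (i : ℕ) + 1 = j → v j < v i → (v i : ℕ) = v j + 1 ∧ f i = f j)
    (i : Fin n) : v (v i) = i ∧ f (v i) = f i := by
  suffices H : ∀ s : ℕ, s ≤ n → ∃ s' : ℕ, s ≤ s' ∧
      ∀ i : Fin n, (i : ℕ) < s' → (v i : ℕ) < s' ∧ v (v i) = i ∧ f (v i) = f i by
    obtain ⟨s', hs, H⟩ := H n le_rfl
    exact (H i (i.2.trans_le hs)).2
  intro s
  induction s with
  | zero => exact fun _ => ⟨0, le_rfl, fun i hi => absurd hi (Nat.not_lt_zero _)⟩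
  | succ s ih =>
    intro hs
    obtain ⟨s', hs', H⟩ := ih (by omega)
    rcases Nat.lt_or_ge s s' with hlt | hge
    · exact ⟨s', hlt, H⟩
    obtain rfl : s = s' := le_antisymm hs' hge
    let a : Fin n := ⟨s, hs⟩
    let b : Fin n := v.symm a
    have hvb : v b = a := v.apply_symm_apply a
    have hge : ∀ x : Fin n, s ≤ (x : ℕ) → s ≤ (v x : ℕ) := fun x hx => by
      by_contra! hlt
      have h1 := H _ hlt
      rw [v.injective h1.2.1] at h1
      omega
    have hsb : s ≤ (b : ℕ) := by
      by_contra! hlt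
      have h1 := (H b hlt).1
      rw [hvb] at h1
      exact absurd h1 (lt_irrefl s)
    have key : ∀ t : ℕ, ∀ x : Fin n, s ≤ (x : ℕ) → (x : ℕ) + t = b →
        (v x : ℕ) = s + t ∧ f x = f b := by
      intro t
      induction t using Nat.strong_induction_on with
      | _ t iht =>
        intro x hx hxt
        rcases Nat.eq_zero_or_pos t with rfl | ht
        · obtain rfl : x = b := Fin.ext hxt
          rw [hvb]
          exact ⟨rfl, rfl⟩
        · let x' : Fin n := ⟨x + 1, by have := b.2; omega⟩
          have hx' := iht (t - 1) (by omega) x' (by simp only [x']; omega)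
            (by simp only [x']; omega)
          have hlt : v x' < v x := by
            by_contra! hle
            have hle' : (v x : ℕ) ≤ v x' := hle
            have hxs := hge x hx
            let y : Fin n := ⟨b - (v x - s), by have := b.2; omega⟩
            have hy := iht (v x - s) (by omega) y (by simp only [y]; omega)
              (by simp only [y]; omega)
            have : y = x := v.injective (Fin.ext (by omega))
            have : (y : ℕ) = x := congrArg _ this
            simp only [y] at this
            omega
          obtain ⟨h1, h2⟩ := h x x' rfl hlt
          exact ⟨by omega, h2.trans hx'.2⟩
    refine ⟨b + 1, by omega, fun x hx => ?_⟩
    rcases Nat.lt_or_ge x s with hxs | hxs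
    · exact ⟨by have := (H x hxs).1; omega, (H x hxs).2⟩
    · have h1 := key (b - x) x hxs (by omega)
      have h2 := key (b - v x) (v x) (by omega) (by omega)
      exact ⟨by omega, Fin.ext (by omega), h2.2.trans h1.2.symm⟩

end Permutation

section Weights

variable {F : Type*} [Field F] {n : ℕ}

/-- The linear form on matrices with coefficients `A`. -/
def weight (A M : Matrix (Fin n) (Fin n) F) : F := ∑ i, ∑ j, A i j * M i j

lemma weight_add_left (A B M : Matrix (Fin n) (Fin n) F) :
    weight (A + B) M = weight A M + weight B M := by
  simp only [weight, Matrix.add_apply, add_mul, Finset.sum_add_distrib]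

lemma weight_congr {A B M N : Matrix (Fin n) (Fin n) F}
    (h : ∀ i j, A i j * M i j = B i j * N i j) : weight A M = weight B N := by
  simp only [weight, h]

lemma weight_eq_zero {A M : Matrix (Fin n) (Fin n) F} (h : ∀ i j, A i j ≠ 0 → M i j = 0) :
    weight A M = 0 :=
  Finset.sum_eq_zero fun i _ => Finset.sum_eq_zero fun j _ => by
    by_cases hA : A i j = 0
    · rw [hA, zero_mul]
    · rw [h i j hA, mul_zero]

lemma weight_mul {A M N : Matrix (Fin n) (Fin n) F} {c : ℕ}
    (hA : ∀ i j, A i j ≠ 0 → i < j ∧ ∀ l, i < l → l < j → (l : ℕ) < c)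
    (hM : IsUnitri c M) (hN : IsUnitri c N) : weight A (M * N) = weight A M + weight A N := by
  simp only [weight, ← Finset.sum_add_distrib, ← mul_add]
  refine Finset.sum_congr rfl fun i _ => Finset.sum_congr rfl fun j _ => ?_
  by_cases h : A i j = 0
  · simp [h]
  · obtain ⟨hij, hl⟩ := hA i j h
    rw [hM.mul_apply hN hij fun l h1 h2 => .inl (hM.left i l (hl l h1 h2) h1)]

/-- The coefficients of the sum of the superdiagonal entries of index at least `c`. -/
def superdiag (F : Type*) [Field F] (n c : ℕ) : Matrix (Fin n) (Fin n) F :=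
  of fun i j => if (i : ℕ) + 1 = j ∧ c ≤ i then 1 else 0

/-- The coefficients of a linear form in the entries above the diagonal of the column `γ`. -/
def colWeight (γ : Fin n) (a : Fin n → F) : Matrix (Fin n) (Fin n) F :=
  of fun i j => if j = γ ∧ i < γ then a i else 0

lemma colWeight_add (γ : Fin n) (a b : Fin n → F) :
    colWeight γ (a + b) = colWeight γ a + colWeight γ b := by
  ext i j
  simp only [colWeight, of_apply, Matrix.add_apply, Pi.add_apply]
  split_ifs <;> simp

lemma weight_colWeight (γ : Fin n) (a : Fin n → F) (M : Matrix (Fin n) (Fin n) F) :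
    weight (colWeight γ a) M = ∑ l, (if l < γ then a l else 0) * M l γ := by
  refine Finset.sum_congr rfl fun l _ => ?_
  rw [Finset.sum_eq_single γ]
  · simp [colWeight]
  · intro j _ hj
    simp [colWeight, hj]
  · simp

lemma superdiag_admissible {c : ℕ} (d : ℕ) (i j : Fin n) (h : superdiag F n c i j ≠ 0) :
    i < j ∧ ∀ l : Fin n, i < l → l < j → (l : ℕ) < d := by
  have h' : (i : ℕ) + 1 = j := by
    by_contra hne
    exact h (if_neg fun h => hne h.1)
  exact ⟨Fin.lt_def.2 (by omega), fun l h1 h2 => by simp only [Fin.lt_def] at h1 h2; omega⟩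

lemma add_admissible (γ : Fin n) (a : Fin n → F) (i j : Fin n)
    (h : (colWeight γ a + superdiag F n γ) i j ≠ 0) :
    i < j ∧ ∀ l : Fin n, i < l → l < j → (l : ℕ) < γ := by
  by_cases hs : superdiag F n γ i j = 0
  · rw [Matrix.add_apply, hs, add_zero] at h
    have h' : j = γ ∧ i < γ := by
      by_contra hne
      exact h (if_neg hne)
    obtain ⟨rfl, hi⟩ := h'
    exact ⟨hi, fun l _ h2 => h2⟩
  · exact superdiag_admissible _ i j hs

end Weights

section Whittaker

variable {F : Type*} [Field F] {n : ℕ}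

/-- The function on `GL_n` given by an additive character and a linear form on matrices. -/
def weightChar (ψ : AddChar F R) (A : Matrix (Fin n) (Fin n) F) (g : GL (Fin n) F) : R :=
  ψ (weight A g)

lemma weightChar_mul [Finite F] (ψ : AddChar F R) {A : Matrix (Fin n) (Fin n) F} {c : ℕ}
    (hA : ∀ i j, A i j ≠ 0 → i < j ∧ ∀ l, i < l → l < j → (l : ℕ) < c) :
    ∀ x ∈ unitri F n c, ∀ y ∈ unitri F n c,
      weightChar ψ A (x * y) = weightChar ψ A x * weightChar ψ A y := fun x hx y hy => by
  rw [weightChar, GeneralLinearGroup.coe_mul, weight_mul hA hx hy, AddChar.map_add_eq_mul]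
  rfl

lemma weightChar_one (ψ : AddChar F R) {A : Matrix (Fin n) (Fin n) F} {c : ℕ}
    (hA : ∀ i j, A i j ≠ 0 → i < j ∧ ∀ l, i < l → l < j → (l : ℕ) < c) :
    weightChar ψ A 1 = 1 := by
  rw [weightChar, weight_eq_zero, AddChar.map_zero_eq_one]
  exact fun i j h => one_apply_ne (hA i j h).1.ne

lemma sum_weightChar_eq_zero [Fintype F] [DecidableEq F] {ψ : AddChar F R} (hψ : ψ.IsPrimitive)
    (B : Matrix (Fin n) (Fin n) F) {γ l : Fin n} (hl : l < γ) {g : GL (Fin n) F}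
    (hg : (g : Matrix (Fin n) (Fin n) F) l γ ≠ 0) :
    ∑ a : Fin n → F, weightChar ψ (colWeight γ a + B) g = 0 := by
  obtain ⟨x, hx⟩ : ∃ x, ψ (x * (g : Matrix (Fin n) (Fin n) F) l γ) ≠ 1 := by
    by_contra! h
    exact hψ hg (DFunLike.ext _ _ fun x => by rw [AddChar.mulShift_apply, mul_comm, h]; rfl)
  have hshift : ∀ a : Fin n → F, weightChar ψ (colWeight γ (a + Pi.single l x) + B) g =
      weightChar ψ (colWeight γ a + B) g * ψ (x * (g : Matrix (Fin n) (Fin n) F) l γ) := fun a => by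
    have : weight (colWeight γ (Pi.single l x)) (g : Matrix (Fin n) (Fin n) F) =
        x * (g : Matrix (Fin n) (Fin n) F) l γ := by
      rw [weight_colWeight, Finset.sum_eq_single l]
      · simp [hl]
      · intro b _ hb
        simp [Pi.single_eq_of_ne hb]
      · simp
    rw [weightChar, colWeight_add, add_right_comm, weight_add_left, this, AddChar.map_add_eq_mul]
    rfl
  have h : ∑ a : Fin n → F, weightChar ψ (colWeight γ a + B) g =
      (∑ a : Fin n → F, weightChar ψ (colWeight γ a + B) g) *
        ψ (x * (g : Matrix (Fin n) (Fin n) F) l γ) := by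
    rw [Finset.sum_mul]
    simp only [← hshift]
    exact (Equiv.sum_comp (Equiv.addRight (Pi.single l x))
      fun a => weightChar ψ (colWeight γ a + B) g).symm
  by_contra hne
  exact hx (mul_left_cancel₀ hne (by rw [mul_one]; exact h.symm))

end Whittaker

section WhittakerVector

variable {F : Type*} [Field F] {n : ℕ}

/-- An invertible matrix with prescribed nonzero row of index `κ`, the rows of index greater than
`κ` being those of the identity matrix. -/
lemma exists_GL_row (κ : Fin n) {a : Fin n → F} {l : Fin n} (hl : l ≤ κ) (ha : a l ≠ 0) :
    ∃ d : GL (Fin n) F, (∀ j, (d : Matrix (Fin n) (Fin n) F) κ j = a j) ∧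
      ∀ i, κ < i → ∀ j, (d : Matrix (Fin n) (Fin n) F) i j = (1 : Matrix (Fin n) (Fin n) F) i j := by
  have hdet : (((1 : Matrix (Fin n) (Fin n) F).updateRow l a).submatrix
      (Equiv.swap l κ) id).det ≠ 0 := by
    rw [det_permute, ← cramer_transpose_apply, transpose_one, cramer_one]
    refine mul_ne_zero ?_ ha
    rcases Int.units_eq_one_or (Equiv.Perm.sign (Equiv.swap l κ)) with h | h <;> simp [h]
  refine ⟨GeneralLinearGroup.mkOfDetNeZero _ hdet, fun j => ?_, fun i hi j => ?_⟩
  · change (updateRow 1 l a) (Equiv.swap l κ κ) j = a j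
    rw [Equiv.swap_apply_right, updateRow_self]
  · change (updateRow 1 l a) (Equiv.swap l κ i) j = (1 : Matrix (Fin n) (Fin n) F) i j
    have hil : i ≠ l := (hl.trans_lt hi).ne'
    rw [Equiv.swap_apply_of_ne_of_ne hil hi.ne', updateRow_ne hil]

lemma exists_conj_weight [Finite F] {κ γ l : Fin n} (hκ : (κ : ℕ) + 1 = γ) {a : Fin n → F}
    (hl : l < γ) (ha : a l ≠ 0) :
    ∃ d : GL (Fin n) F, ∀ u ∈ unitri F n γ, d⁻¹ * u * d ∈ unitri F n γ ∧
      weight (colWeight γ a + superdiag F n γ) (d⁻¹ * u * d : GL (Fin n) F) =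
        weight (superdiag F n 0) (u : GL (Fin n) F).1 := by
  obtain ⟨d, hd1, hd2⟩ := exists_GL_row κ (a := fun i => if i < γ then a i else 0) (l := l)
    (Fin.le_def.2 (by rw [Fin.lt_def] at hl; omega)) (by simpa [hl] using ha)
  refine ⟨d, fun u hu => ?_⟩
  have hγ : ∀ i : Fin n, κ < i ↔ γ ≤ i := fun i => by
    rw [Fin.lt_def, Fin.le_def]; omega
  set M : Matrix (Fin n) (Fin n) F := u.1 with hM
  set Z : Matrix (Fin n) (Fin n) F := (d⁻¹ : GL (Fin n) F) * (M - 1) with hZ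
  have hu' : IsUnitri γ M := hu
  have hdZ : (d : Matrix (Fin n) (Fin n) F) * Z = M - 1 := by
    rw [hZ, ← mul_assoc, ← GeneralLinearGroup.coe_mul, mul_inv_cancel, GeneralLinearGroup.coe_one,
      one_mul]
  have hYcol : ∀ i j : Fin n, j < γ → (M - 1) i j = 0 := fun i j hj => by
    rw [Matrix.sub_apply, sub_eq_zero]
    by_cases hij : i = j
    · rw [hij, hu'.diag, one_apply_eq]
    · rw [one_apply_ne hij, hu'.eq_zero hij (.inr hj)]
  have hYd : (M - 1) * (d : Matrix (Fin n) (Fin n) F) = M - 1 := by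
    ext i j
    rw [Matrix.mul_apply]
    have : ∀ l, (M - 1) i l * (d : Matrix (Fin n) (Fin n) F) l j =
        (M - 1) i l * (1 : Matrix (Fin n) (Fin n) F) l j := fun l => by
      rcases lt_or_ge l γ with h | h
      · rw [hYcol i l h, zero_mul, zero_mul]
      · rw [hd2 l ((hγ l).2 h)]
    rw [Finset.sum_congr rfl fun l _ => this l, ← Matrix.mul_apply, mul_one]
  have hconj : ((d⁻¹ * u * d : GL (Fin n) F) : Matrix (Fin n) (Fin n) F) = 1 + Z := by
    rw [GeneralLinearGroup.coe_mul, GeneralLinearGroup.coe_mul, ← hM, hZ]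
    conv_lhs => rw [← add_sub_cancel (1 : Matrix (Fin n) (Fin n) F) M]
    rw [mul_add, mul_one, add_mul, mul_assoc _ (M - 1), hYd, ← GeneralLinearGroup.coe_mul,
      inv_mul_cancel, GeneralLinearGroup.coe_one]
  have hZcol : ∀ i j : Fin n, j < γ → Z i j = 0 := fun i j hj => by
    rw [hZ, Matrix.mul_apply]
    exact Finset.sum_eq_zero fun l _ => by rw [hYcol l j hj, mul_zero]
  have hZrow : ∀ i j : Fin n, γ ≤ i → Z i j = (M - 1) i j := fun i j hi => by
    rw [← hdZ, Matrix.mul_apply]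
    have : ∀ l, (d : Matrix (Fin n) (Fin n) F) i l * Z l j =
        (1 : Matrix (Fin n) (Fin n) F) i l * Z l j := fun l => by rw [hd2 i ((hγ i).2 hi)]
    rw [Finset.sum_congr rfl fun l _ => this l, ← Matrix.mul_apply, one_mul]
  have hκγ : κ < γ := Fin.lt_def.2 (by omega)
  have hZκ : ∑ l, (if l < γ then a l else 0) * Z l γ = M κ γ := by
    have : (M - 1) κ γ = M κ γ := by rw [Matrix.sub_apply, one_apply_ne hκγ.ne, sub_zero]
    rw [← this, ← hdZ, Matrix.mul_apply]
    simp only [hd1]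
  have hrow : ∀ i j : Fin n, γ ≤ i → (1 + Z) i j = M i j := fun i j hi => by
    rw [Matrix.add_apply, hZrow i j hi, Matrix.sub_apply, add_sub_cancel]
  have hcol : ∀ i j : Fin n, j < γ → (1 + Z) i j = (1 : Matrix (Fin n) (Fin n) F) i j :=
    fun i j hj => by rw [Matrix.add_apply, hZcol i j hj, add_zero]
  refine ⟨?_, ?_⟩
  · rw [mem_unitri, hconj]
    refine ⟨fun i j hij => ?_, fun i => ?_, fun i j hj hij => ?_⟩
    · rcases lt_or_ge j γ with h | h
      · rw [hcol i j h, one_apply_ne hij.ne']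
      · rw [hrow i j (h.trans hij.le), hu'.lower i j hij]
    · rcases lt_or_ge i γ with h | h
      · rw [hcol i i h, one_apply_eq]
      · rw [hrow i i h, hu'.diag]
    · rw [hcol i j hj, one_apply_ne hij.ne]
  · have h0 : superdiag F n 0 = superdiag F n γ + colWeight γ (Pi.single κ 1) +
        of fun i j : Fin n => if (i : ℕ) + 1 = j ∧ j < γ then (1 : F) else 0 := by
      ext i j
      rw [Matrix.add_apply, Matrix.add_apply]
      simp only [superdiag, colWeight, of_apply]
      by_cases hij : (i : ℕ) + 1 = j
      · rcases lt_trichotomy j γ with h | h | h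
        · have h1 : ¬ (γ : ℕ) ≤ i := by rw [Fin.lt_def] at h; omega
          simp [hij, h, h.ne, h1]
        · subst h
          obtain rfl : i = κ := Fin.ext (by omega)
          simp [hij, hκγ]
        · have h1 : (γ : ℕ) ≤ i := by rw [Fin.lt_def] at h; omega
          simp [hij, h.ne', h1, h.asymm]
      · have : ¬ (j = γ ∧ i = κ) := by rintro ⟨rfl, rfl⟩; exact hij hκ
        rcases Classical.em (j = γ) with rfl | h
        · have hi : i ≠ κ := fun h => this ⟨rfl, h⟩
          simp [hij, Pi.single_eq_of_ne hi]
        · simp [hij, h]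
    have h1 : weight (of fun i j : Fin n => if (i : ℕ) + 1 = j ∧ j < γ then (1 : F) else 0) M = 0 :=
      weight_eq_zero fun i j h => by
        have h' : (i : ℕ) + 1 = j ∧ j < γ := by
          by_contra hne
          exact h (if_neg hne)
        exact hu'.eq_zero (Fin.ne_of_lt (Fin.lt_def.2 (by omega))) (.inr h'.2)
    have h2 : weight (colWeight γ (Pi.single κ 1)) M = M κ γ := by
      rw [weight_colWeight, Finset.sum_eq_single κ]
      · simp [hκγ]
      · intro b _ hb
        simp [Pi.single_eq_of_ne hb]
      · simp
    have h3 : weight (superdiag F n γ) (1 + Z) = weight (superdiag F n γ) M :=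
      weight_congr fun i j => by
        by_cases hs : superdiag F n γ i j = 0
        · rw [hs, zero_mul, zero_mul]
        · have hi : γ ≤ i := by
            by_contra hne
            exact hs (if_neg fun h => hne h.2)
          rw [hrow i j hi]
    have h4 : weight (colWeight γ a) (1 + Z) = M κ γ := by
      rw [weight_colWeight, ← hZκ]
      refine Finset.sum_congr rfl fun l _ => ?_
      by_cases hlγ : l < γ
      · rw [Matrix.add_apply, one_apply_ne hlγ.ne, zero_add]
      · simp [hlγ]
    rw [hconj, h0, weight_add_left, weight_add_left, weight_add_left, h1, h2, h3, h4, add_zero,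
      add_comm]

/-- Descent step in the construction of a Whittaker vector. -/
lemma exists_colWeight_eigenvector [Finite F] {ψ : AddChar F R} (hψ : ψ.IsPrimitive)
    (hchar : ringChar R ≠ ringChar F) (π : Representation R (GL (Fin n) F) V) (γ : Fin n)
    {w : V} (hw0 : w ≠ 0)
    (hw : ∀ u ∈ unitri F n (γ + 1), π u w = weightChar ψ (superdiag F n 0) u • w) :
    ∃ (a : Fin n → F) (w' : V), w' ≠ 0 ∧ ∀ u ∈ unitri F n γ,
      π u w' = weightChar ψ (colWeight γ a + superdiag F n γ) u • w' := by
  classical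
  have := Fintype.ofFinite F
  let e : (Fin n → F) → V := fun a =>
    eigenProj π (unitri F n γ) (weightChar ψ (colWeight γ a + superdiag F n γ)) w
  obtain ⟨a, ha⟩ : ∃ a, e a ≠ 0 := by
    by_contra! h
    have hterm : ∀ u : unitri F n γ,
        (∑ a : Fin n → F, weightChar ψ (colWeight γ a + superdiag F n γ) (u : GL (Fin n) F)⁻¹) •
          π u w = if u ∈ (unitri F n (γ + 1)).subgroupOf (unitri F n γ) then
            ((Fintype.card (Fin n → F) : R)) • w else 0 := fun u => by
      have hui : IsUnitri γ ((u : GL (Fin n) F)⁻¹ : GL (Fin n) F).1 := inv_mem u.2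
      split_ifs with hu
      · rw [Subgroup.mem_subgroupOf] at hu
        have hui' : IsUnitri (γ + 1) ((u : GL (Fin n) F)⁻¹ : GL (Fin n) F).1 := inv_mem hu
        have h1 : ∀ a, weightChar ψ (colWeight γ a + superdiag F n γ) (u : GL (Fin n) F)⁻¹ =
            weightChar ψ (superdiag F n 0) (u : GL (Fin n) F)⁻¹ := fun a => by
          refine congrArg ψ (weight_congr fun i j => ?_)
          by_cases hij : i < j
          · rcases Nat.lt_or_ge j (γ + 1) with h | h
            · rw [hui'.left i j h hij, mul_zero, mul_zero]
            · have hj : ¬ j = γ := by rintro rfl; omega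
              have hi : (i : ℕ) + 1 = j → (γ : ℕ) ≤ i := by omega
              congr 1
              simp only [colWeight, superdiag, Matrix.add_apply, of_apply, hj, false_and, if_false,
                zero_add, zero_le, and_true]
              split_ifs <;> tauto
          · have h1 : ¬ (i : ℕ) + 1 = j := fun h => hij (Fin.lt_def.2 (by omega))
            have h2 : ¬ (j = γ ∧ i < γ) := by rintro ⟨rfl, h⟩; exact hij h
            simp [colWeight, superdiag, h1, h2]
        rw [Finset.sum_congr rfl fun a _ => h1 a, Finset.sum_const, Finset.card_univ, hw _ hu,
          smul_smul, ← Nat.cast_smul_eq_nsmul R, smul_eq_mul, mul_assoc,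
          ← weightChar_mul ψ (superdiag_admissible (γ + 1)) _ (inv_mem hu) _ hu, inv_mul_cancel,
          weightChar_one ψ (superdiag_admissible 0), mul_one]
      · obtain ⟨l, hl, hne⟩ : ∃ l, l < γ ∧ ((u : GL (Fin n) F)⁻¹ : GL (Fin n) F).1 l γ ≠ 0 := by
          by_contra! hcon
          refine hu (Subgroup.mem_subgroupOf.2 (inv_mem_iff.1 ⟨hui.lower, hui.diag, ?_⟩))
          intro i j hj hij
          rcases Nat.lt_succ_iff_lt_or_eq.1 hj with h | h
          · exact hui.left i j h hij
          · obtain rfl : j = γ := Fin.ext h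
            exact hcon i hij
        rw [sum_weightChar_eq_zero hψ _ hl hne, zero_smul]
    have hsum : ∑ a, e a = 0 := Finset.sum_eq_zero fun a _ => h a
    simp only [e, eigenProj_apply] at hsum
    rw [Finset.sum_comm] at hsum
    simp only [← Finset.sum_smul, hterm] at hsum
    rw [← Finset.sum_filter, Finset.sum_const, ← Nat.cast_smul_eq_nsmul R, smul_smul,
      ← Fintype.card_subtype] at hsum
    rcases mul_eq_zero.1 ((smul_eq_zero.1 hsum).resolve_right hw0) with h1 | h1
    · exact card_ne_zero_of_isPGroup
        ((isPGroup_unitri γ).to_subgroup ((unitri F n (γ + 1)).subgroupOf (unitri F n γ))) hchar h1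
    · rw [Fintype.card_fun, Nat.cast_pow] at h1
      have hF : IsPGroup (ringChar F) (Multiplicative F) := fun x => ⟨1, by
        rw [pow_one]
        exact Multiplicative.toAdd.injective (by simp)⟩
      refine card_ne_zero_of_isPGroup hF hchar ?_
      rw [Fintype.card_multiplicative]
      exact eq_zero_of_pow_eq_zero h1
  exact ⟨a, e a, ha, fun u hu => map_eigenProj π _ (weightChar_one ψ (add_admissible γ a))
    (weightChar_mul ψ (add_admissible γ a)) hu w⟩

end WhittakerVector

section WhittakerModel

variable {F : Type*} [Field F] {n : ℕ}

/-- The standard nondegenerate character of the upper unitriangular group. -/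
def genericChar (ψ : AddChar F R) (g : GL (Fin n) F) : R := weightChar ψ (superdiag F n 0) g

lemma genericChar_mul [Finite F] (ψ : AddChar F R) : ∀ x ∈ unitri F n 0, ∀ y ∈ unitri F n 0,
    genericChar ψ (x * y) = genericChar ψ x * genericChar ψ y :=
  weightChar_mul ψ (superdiag_admissible 0)

lemma genericChar_one (ψ : AddChar F R) : genericChar ψ (1 : GL (Fin n) F) = 1 :=
  weightChar_one ψ (superdiag_admissible 0)

/-- The coinvariants of `π` under the unipotent radical of every standard maximal proper parabolic
subgroup vanish. -/
def IsCuspidalStandard [Finite F] (π : Representation R (GL (Fin n) F) V) : Prop :=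
  ∀ c, 0 < c → c < n →
    Submodule.span R {x : V | ∃ u ∈ unipRadical F n c, ∃ v : V, x = v - π u v} = ⊤

variable [Finite F]

lemma exists_whittaker_vector_unitri [Nontrivial V] {ψ : AddChar F R} (hψ : ψ.IsPrimitive)
    (hchar : ringChar R ≠ ringChar F) {π : Representation R (GL (Fin n) F) V}
    (hcusp : IsCuspidalStandard π) (t : ℕ) : ∀ c, c + t = n →
    ∃ w : V, w ≠ 0 ∧ ∀ u ∈ unitri F n c, π u w = genericChar ψ u • w := by
  classical
  have := Fintype.ofFinite F
  induction t with
  | zero =>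
    rintro c rfl
    obtain ⟨w, hw⟩ := exists_ne (0 : V)
    refine ⟨w, hw, fun u hu => ?_⟩
    obtain rfl : u = 1 := by
      ext i j
      rcases eq_or_ne i j with rfl | hij
      · rw [hu.diag, GeneralLinearGroup.coe_one, one_apply_eq]
      · rw [hu.eq_zero hij (.inr j.2), GeneralLinearGroup.coe_one, one_apply_ne hij]
    rw [map_one, Module.End.one_apply, genericChar_one, one_smul]
  | succ t ih =>
    intro c hc
    obtain ⟨w, hw0, hw⟩ := ih (c + 1) (by omega)
    rcases Nat.eq_zero_or_pos c with rfl | hpos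
    · refine ⟨w, hw0, fun u hu => hw u ?_⟩
      rw [mem_unitri] at hu ⊢
      refine ⟨hu.lower, hu.diag, fun i j hj hij => ?_⟩
      rw [Fin.lt_def] at hij
      omega
    let γ : Fin n := ⟨c, by omega⟩
    obtain ⟨a, w', hw'0, hw'⟩ := exists_colWeight_eigenvector hψ hchar π γ hw0 hw
    obtain ⟨l, hl, ha⟩ : ∃ l, l < γ ∧ a l ≠ 0 := by
      by_contra! h
      refine hw'0 (eq_zero_of_invariant_of_coinvariants π (unipRadical F n c) ?_
        (hcusp c hpos (by omega)) fun u hu => ?_)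
      · refine card_ne_zero_of_isPGroup (F := F) ?_ hchar
        exact (isPGroup_unitri c).to_le fun u hu => hu.1
      · rw [hw' u hu.1, weightChar, weight_eq_zero, AddChar.map_zero_eq_one, one_smul]
        intro i j hij
        by_cases hs : superdiag F n γ i j = 0
        · rw [Matrix.add_apply, hs, add_zero] at hij
          have h' : j = γ ∧ i < γ := by
            by_contra hne
            exact hij (if_neg hne)
          exact absurd ((if_pos h').trans (h i h'.2)) hij
        · have h' : (i : ℕ) + 1 = j ∧ (γ : ℕ) ≤ i := by
            by_contra hne
            exact hs (if_neg hne)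
          exact hu.2 i j h'.2 (Fin.lt_def.2 (by omega))
    obtain ⟨d, hd⟩ := exists_conj_weight (κ := ⟨c - 1, by omega⟩) (γ := γ)
      (Nat.sub_add_cancel hpos) hl ha
    refine ⟨π d w', fun h0 => hw'0 ?_, fun u hu => ?_⟩
    · rw [← Module.End.one_apply (R := R) w', ← map_one π, ← inv_mul_cancel d, map_mul,
        Module.End.mul_apply, h0, map_zero]
    · obtain ⟨h1, h2⟩ := hd u hu
      have h3 : u * d = d * (d⁻¹ * u * d) := by simp [mul_assoc]
      rw [← Module.End.mul_apply, ← map_mul, h3, map_mul, Module.End.mul_apply, hw' _ h1,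
        map_smul, weightChar, h2]
      rfl

/-- A cuspidal representation has a Whittaker vector. -/
lemma exists_whittaker_vector [Nontrivial V] {ψ : AddChar F R} (hψ : ψ.IsPrimitive)
    (hchar : ringChar R ≠ ringChar F) {π : Representation R (GL (Fin n) F) V}
    (hcusp : IsCuspidalStandard π) :
    ∃ w : V, w ≠ 0 ∧ ∀ u ∈ unitri F n 0, π u w = genericChar ψ u • w :=
  exists_whittaker_vector_unitri hψ hchar hcusp n 0 (zero_add n)

lemma exists_whittaker_functional (ψ : AddChar F R) (hchar : ringChar R ≠ ringChar F)
    {π : Representation R (GL (Fin n) F) V} {w : V} (hw0 : w ≠ 0)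
    (hw : ∀ u ∈ unitri F n 0, π u w = genericChar ψ u • w) :
    ∃ l : Module.Dual R V, l ≠ 0 ∧ ∀ u ∈ unitri F n 0, ∀ v, l (π u v) = genericChar ψ u * l v := by
  classical
  have := Fintype.ofFinite F
  obtain ⟨μ, hμ⟩ := not_forall.1 (mt (Module.forall_dual_apply_eq_zero_iff R w).1 hw0)
  refine ⟨μ ∘ₗ eigenProj π (unitri F n 0) (genericChar ψ), fun h => ?_, fun u hu v => ?_⟩
  · have h' := LinearMap.congr_fun h w
    rw [LinearMap.comp_apply, eigenProj_of_eigenvector π _ (genericChar_one ψ) (genericChar_mul ψ)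
      hw, map_smul, LinearMap.zero_apply, smul_eq_zero] at h'
    exact h'.elim (card_ne_zero_of_isPGroup (isPGroup_unitri 0) hchar) hμ
  · rw [LinearMap.comp_apply, eigenProj_map π _ (genericChar_one ψ) (genericChar_mul ψ) hu,
      map_smul, smul_eq_mul, LinearMap.comp_apply]

end WhittakerModel

section AntiTranspose

variable {F : Type*} [Field F] {n : ℕ}

/-- The transpose along the antidiagonal, twisted by the signs `ε ^ (i + j)`. -/
def antiTranspose (ε : F) (M : Matrix (Fin n) (Fin n) F) : Matrix (Fin n) (Fin n) F :=
  of fun i j => ε ^ (i + j : ℕ) * M j.rev i.rev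

lemma antiTranspose_apply (ε : F) (M : Matrix (Fin n) (Fin n) F) (i j : Fin n) :
    antiTranspose ε M i j = ε ^ (i + j : ℕ) * M j.rev i.rev := rfl

variable {ε : F}

lemma pow_add_self_eq_one (hε : ε * ε = 1) (t : ℕ) : ε ^ (t + t) = 1 := by
  rw [pow_add, ← mul_pow, hε, one_pow]

lemma antiTranspose_one (hε : ε * ε = 1) :
    antiTranspose ε (1 : Matrix (Fin n) (Fin n) F) = 1 := by
  ext i j
  rw [antiTranspose_apply]
  rcases eq_or_ne i j with rfl | h
  · rw [one_apply_eq, one_apply_eq, mul_one, pow_add_self_eq_one hε]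
  · rw [one_apply_ne h, one_apply_ne (fun h' => h (Fin.rev_injective h').symm), mul_zero]

lemma antiTranspose_mul (hε : ε * ε = 1) (M N : Matrix (Fin n) (Fin n) F) :
    antiTranspose ε (M * N) = antiTranspose ε N * antiTranspose ε M := by
  ext i j
  rw [antiTranspose_apply, Matrix.mul_apply, Matrix.mul_apply, Finset.mul_sum]
  refine Fintype.sum_equiv Fin.revPerm _ _ fun l => ?_
  simp only [Fin.revPerm_apply, antiTranspose_apply, Fin.rev_rev]
  have : ε ^ (i + j : ℕ) = ε ^ (i + l.rev : ℕ) * ε ^ (l.rev + j : ℕ) := by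
    rw [← pow_add, show (i + l.rev + (l.rev + j) : ℕ) = l.rev + l.rev + (i + j) by omega,
      pow_add _ (l.rev + l.rev : ℕ), pow_add_self_eq_one hε, one_mul]
  rw [this]
  ring

/-- The automorphism of `GL_n` sending `g` to the twisted antitranspose of `g⁻¹`. -/
def antiTransposeInv (hε : ε * ε = 1) : GL (Fin n) F →* GL (Fin n) F where
  toFun g := ⟨antiTranspose ε (g⁻¹ : GL (Fin n) F).1, antiTranspose ε g.1,
    by rw [← antiTranspose_mul hε, ← GeneralLinearGroup.coe_mul, mul_inv_cancel,
      GeneralLinearGroup.coe_one, antiTranspose_one hε],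
    by rw [← antiTranspose_mul hε, ← GeneralLinearGroup.coe_mul, inv_mul_cancel,
      GeneralLinearGroup.coe_one, antiTranspose_one hε]⟩
  map_one' := Units.ext (by
    change antiTranspose ε (1⁻¹ : GL (Fin n) F).1 = 1
    rw [inv_one, GeneralLinearGroup.coe_one, antiTranspose_one hε])
  map_mul' g h := Units.ext (by
    change antiTranspose ε ((g * h)⁻¹ : GL (Fin n) F).1 =
      antiTranspose ε (g⁻¹ : GL (Fin n) F).1 * antiTranspose ε (h⁻¹ : GL (Fin n) F).1
    rw [_root_.mul_inv_rev, GeneralLinearGroup.coe_mul, antiTranspose_mul hε])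

lemma coe_antiTransposeInv (hε : ε * ε = 1) (g : GL (Fin n) F) :
    (antiTransposeInv hε g).1 = antiTranspose ε (g⁻¹ : GL (Fin n) F).1 := rfl

lemma antiTranspose_antiTranspose (hε : ε * ε = 1) (M : Matrix (Fin n) (Fin n) F) :
    antiTranspose ε (antiTranspose ε M) = M := by
  ext i j
  rw [antiTranspose_apply, antiTranspose_apply, Fin.rev_rev, Fin.rev_rev, ← mul_assoc, ← pow_add,
    Fin.val_rev, Fin.val_rev, show (i + j + (n - (j + 1) + (n - (i + 1))) : ℕ) =
      (n - 1) + (n - 1) by omega, pow_add_self_eq_one hε, one_mul]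

lemma antiTransposeInv_antiTransposeInv (hε : ε * ε = 1) (g : GL (Fin n) F) :
    antiTransposeInv hε (antiTransposeInv hε g) = g := by
  apply Units.ext
  rw [coe_antiTransposeInv, ← map_inv, coe_antiTransposeInv, inv_inv,
    antiTranspose_antiTranspose hε]

lemma IsUnitri.antiTranspose (hε : ε * ε = 1) {M : Matrix (Fin n) (Fin n) F} (h : IsUnitri 0 M) :
    IsUnitri 0 (antiTranspose ε M) where
  lower i j hij := by rw [antiTranspose_apply, h.lower _ _ (Fin.rev_lt_rev.2 hij), mul_zero]
  diag i := by rw [antiTranspose_apply, h.diag, mul_one, pow_add_self_eq_one hε]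
  left _ _ h := absurd h (Nat.not_lt_zero _)

lemma weight_superdiag_antiTranspose (hε : ε * ε = 1) (M : Matrix (Fin n) (Fin n) F) :
    weight (superdiag F n 0) (antiTranspose ε M) = ε * weight (superdiag F n 0) M := by
  simp only [weight, Finset.mul_sum]
  rw [Finset.sum_comm]
  refine Fintype.sum_equiv Fin.revPerm _ _ fun i => Fintype.sum_equiv Fin.revPerm _ _ fun j => ?_
  have h : (j : ℕ) + 1 = i ↔ (i.rev : ℕ) + 1 = j.rev := by
    rw [Fin.val_rev, Fin.val_rev]; omega
  simp only [Fin.revPerm_apply, superdiag, of_apply, zero_le, and_true, h, antiTranspose_apply]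
  split_ifs with h'
  · rw [one_mul, one_mul, ← h.2 h', ← add_assoc, pow_succ, pow_add_self_eq_one hε, one_mul]
  · ring

/-- A monomial matrix satisfying the given condition at the ascents of the underlying permutation
is, up to sign, fixed by the twisted antitranspose. -/
lemma antiTranspose_monomialMatrix (hε : ε * ε = 1) {w : Equiv.Perm (Fin n)} {c : Fin n → F}
    (h : ∀ i j : Fin n, (i : ℕ) + 1 = j → w i < w j → (w j : ℕ) = w i + 1 ∧ c j = ε * c i) :
    antiTranspose ε (monomialMatrix w c) = ε ^ (n - 1) • monomialMatrix w c := by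
  have key := apply_apply_eq_of_descents (w.trans Fin.revPerm) (fun i : Fin n => ε ^ (i : ℕ) * c i)
    fun i j hij hlt => by
      simp only [Equiv.trans_apply, Fin.revPerm_apply, Fin.rev_lt_rev] at hlt
      obtain ⟨h1, h2⟩ := h i j hij hlt
      refine ⟨?_, ?_⟩
      · simp only [Equiv.trans_apply, Fin.revPerm_apply, Fin.val_rev]
        omega
      · rw [h2, ← hij, pow_succ, mul_assoc, ← mul_assoc ε, hε, one_mul]
  simp only [Equiv.trans_apply, Fin.revPerm_apply] at key
  ext i j
  rw [antiTranspose_apply, Matrix.smul_apply, monomialMatrix_apply, monomialMatrix_apply,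
    smul_eq_mul]
  have hiff : j.rev = w i.rev ↔ i = w j := by
    have h1 := (key i.rev).1
    have h2 := (key j).1
    constructor
    · intro hj
      rw [← hj, Fin.rev_rev] at h1
      exact (Fin.rev_injective h1).symm
    · rintro rfl
      rw [← h2, Fin.rev_rev, h2]
  by_cases hi : i = w j
  · rw [if_pos hi, if_pos (hiff.2 hi), hi]
    have h2 : ε ^ ((w j).rev : ℕ) * c (w j).rev = ε ^ (j : ℕ) * c j := (key j).2
    have h3 : c (w j).rev = ε ^ ((w j).rev : ℕ) * (ε ^ (j : ℕ) * c j) := by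
      rw [← h2, ← mul_assoc, ← pow_add, pow_add_self_eq_one hε, one_mul]
    rw [h3, ← mul_assoc, ← mul_assoc, ← pow_add, ← pow_add, Fin.val_rev,
      show (w j + j + (n - (w j + 1)) + j : ℕ) = j + j + (n - 1) by omega, pow_add _ (j + j : ℕ),
      pow_add_self_eq_one hε, one_mul]
  · rw [if_neg hi, if_neg (mt hiff.1 hi), mul_zero, mul_zero]

variable [Finite F]

lemma weight_superdiag_inv {u : GL (Fin n) F} (hu : u ∈ unitri F n 0) :
    weight (superdiag F n 0) (u⁻¹ : GL (Fin n) F).1 = -weight (superdiag F n 0) u.1 := by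
  rw [eq_neg_iff_add_eq_zero, ← weight_mul (superdiag_admissible 0) (inv_mem hu) hu,
    ← GeneralLinearGroup.coe_mul, inv_mul_cancel]
  exact weight_eq_zero fun i j h => one_apply_ne (superdiag_admissible 0 i j h).1.ne

lemma antiTransposeInv_mem_unitri (hε : ε * ε = 1) {u : GL (Fin n) F} (hu : u ∈ unitri F n 0) :
    antiTransposeInv hε u ∈ unitri F n 0 :=
  IsUnitri.antiTranspose hε (M := (u⁻¹ : GL (Fin n) F).1) (inv_mem hu)

lemma weight_superdiag_antiTransposeInv (hε : ε * ε = 1) {u : GL (Fin n) F}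
    (hu : u ∈ unitri F n 0) : weight (superdiag F n 0) (antiTransposeInv hε u).1 =
      -ε * weight (superdiag F n 0) u.1 := by
  rw [coe_antiTransposeInv, weight_superdiag_antiTranspose hε, weight_superdiag_inv hu]
  ring

end AntiTranspose

section Equivariance

variable {F : Type*} [Field F] {n : ℕ}

lemma weight_add_right (A M N : Matrix (Fin n) (Fin n) F) :
    weight A (M + N) = weight A M + weight A N := by
  simp only [weight, Matrix.add_apply, mul_add, Finset.sum_add_distrib]

lemma weight_single (A : Matrix (Fin n) (Fin n) F) (i j : Fin n) (x : F) :
    weight A (Matrix.single i j x) = A i j * x := by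
  rw [weight, Finset.sum_eq_single i, Finset.sum_eq_single j, single_apply_same]
  · intro b _ hb
    rw [single_apply_of_ne _ _ _ _ _ fun h => hb h.2.symm, mul_zero]
  · simp
  · intro a _ ha
    exact Finset.sum_eq_zero fun b _ => by
      rw [single_apply_of_ne _ _ _ _ _ fun h => ha h.1.symm, mul_zero]
  · simp

lemma weight_superdiag_one : weight (superdiag F n 0) 1 = 0 :=
  weight_eq_zero fun i j h => one_apply_ne (superdiag_admissible 0 i j h).1.ne

lemma isUnitri_one_add {X : Matrix (Fin n) (Fin n) F} (hX : ∀ i j, j ≤ i → X i j = 0) :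
    IsUnitri 0 (1 + X) where
  lower i j hij := by rw [Matrix.add_apply, one_apply_ne hij.ne', hX i j hij.le, add_zero]
  diag i := by rw [Matrix.add_apply, one_apply_eq, hX i i le_rfl, add_zero]
  left _ _ h := absurd h (Nat.not_lt_zero _)

lemma single_eq_zero_of_le {i j : Fin n} (hij : i < j) (x : F) {a b : Fin n} (h : b ≤ a) :
    Matrix.single i j x a b = 0 :=
  single_apply_of_ne _ _ _ _ _ fun ⟨h1, h2⟩ => (h2.le.trans (h.trans h1.symm.le)).not_gt hij

lemma monomialMatrix_mul_single {w : Equiv.Perm (Fin n)} {c : Fin n → F} {i j : Fin n}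
    (hc : c j ≠ 0) (x : F) :
    monomialMatrix w c * Matrix.single i j x =
      Matrix.single (w i) (w j) (x * (c i / c j)) * monomialMatrix w c := by
  ext a b
  obtain ⟨a, rfl⟩ := w.surjective a
  rw [monomialMatrix_mul_apply, mul_monomialMatrix_apply]
  by_cases h : i = a ∧ j = b
  · obtain ⟨rfl, rfl⟩ := h
    rw [single_apply_same, single_apply_same]
    field_simp
  · rw [single_apply_of_ne _ _ _ _ _ h, single_apply_of_ne _ _ _ _ _
      fun h' => h ⟨w.injective h'.1, w.injective h'.2⟩, mul_zero, zero_mul]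

lemma exists_apply_mul_ne_one {ψ : AddChar F R} (hψ : ψ.IsPrimitive) {t : F} (ht : t ≠ 0) :
    ∃ x, ψ (x * t) ≠ 1 := by
  by_contra! h
  exact hψ ht (DFunLike.ext _ _ fun x => by rw [AddChar.mulShift_apply, mul_comm, h]; rfl)

lemma superdiag_zero_apply (i j : Fin n) :
    superdiag F n 0 i j = if (i : ℕ) + 1 = j then 1 else 0 := by
  simp [superdiag]

lemma apply_eq_of_forall_le (p : Equiv.Perm (Fin n)) (h : ∀ b, p b ≤ b) (b : Fin n) : p b = b := by
  induction b using WellFoundedLT.induction with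
  | _ b ih =>
    rcases (h b).lt_or_eq with hlt | heq
    · exact p.injective (ih _ hlt)
    · exact heq

variable [Finite F]

/-- A function on `GL_n` transforming on both sides under the generic character vanishes if it
vanishes at the monomial matrices fixed by the antitranspose. -/
lemma eq_zero_of_biequivariant {ψ : AddChar F R} (hψ : ψ.IsPrimitive) {D : GL (Fin n) F → R}
    (hl : ∀ u ∈ unitri F n 0, ∀ g, D (u * g) = genericChar ψ u * D g)
    (hr : ∀ u ∈ unitri F n 0, ∀ g, D (g * u) = genericChar ψ u * D g)
    (h0 : ∀ g : GL (Fin n) F, antiTranspose 1 g.1 = g.1 → D g = 0) (g : GL (Fin n) F) :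
    D g = 0 := by
  obtain ⟨u₁, hu₁, u₂, hu₂, w, c, hc, hN⟩ := exists_unitri_mul_mul_eq_monomialMatrix g
  obtain ⟨N, hNdef⟩ : ∃ N, N = u₁ * g * u₂ := ⟨_, rfl⟩
  rw [← hNdef] at hN
  have hg : g = u₁⁻¹ * (N * u₂⁻¹) := by simp [hNdef, mul_assoc]
  suffices hDN : D N = 0 by
    rw [hg, hl _ (inv_mem hu₁), hr _ (inv_mem hu₂), hDN, mul_zero, mul_zero]
  by_cases hgood : ∀ i j : Fin n, (i : ℕ) + 1 = j → w i < w j →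
      (w j : ℕ) = w i + 1 ∧ c j = 1 * c i
  · refine h0 N ?_
    rw [hN, antiTranspose_monomialMatrix (mul_one 1) hgood, one_pow, one_smul]
  · push Not at hgood
    obtain ⟨i, j, hij, hw, hne⟩ := hgood
    have hlt : i < j := Fin.lt_def.2 (by omega)
    let t : F := superdiag F n 0 (w i) (w j) * (c i / c j)
    have ht : 1 - t ≠ 0 := by
      simp only [t, superdiag_zero_apply]
      split_ifs with h
      · have := hne h.symm
        rw [one_mul] at this ⊢
        rw [sub_ne_zero, ne_comm, ne_eq, div_eq_one_iff_eq (hc j)]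
        exact this.symm
      · simp
    obtain ⟨x, hx⟩ := exists_apply_mul_ne_one hψ ht
    have hy := isUnitri_one_add fun a b h => single_eq_zero_of_le hlt x (a := a) (b := b) h
    have hy' := isUnitri_one_add
      fun a b h => single_eq_zero_of_le hw (x * (c i / c j)) (a := a) (b := b) h
    have hcomm : N * hy.toGL = hy'.toGL * N := by
      apply Units.ext
      rw [GeneralLinearGroup.coe_mul, GeneralLinearGroup.coe_mul, hy.coe_toGL, hy'.coe_toGL, hN,
        mul_add, add_mul, monomialMatrix_mul_single (hc j), mul_one, one_mul]
    have hχ : genericChar ψ hy.toGL = ψ x := by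
      rw [genericChar, weightChar, hy.coe_toGL, weight_add_right, weight_superdiag_one,
        weight_single, superdiag_zero_apply, if_pos hij, zero_add, one_mul]
    have hχ' : genericChar ψ hy'.toGL = ψ (x * t) := by
      rw [genericChar, weightChar, hy'.coe_toGL, weight_add_right, weight_superdiag_one,
        weight_single, zero_add, mul_left_comm]
    have h1 := hr _ hy.toGL_mem N
    rw [hcomm, hl _ hy'.toGL_mem, hχ, hχ'] at h1
    by_contra hD
    refine hx ?_
    rw [mul_sub, mul_one, sub_eq_add_neg, AddChar.map_add_eq_mul, ← mul_right_cancel₀ hD h1,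
      ← AddChar.map_add_eq_mul, add_neg_cancel, AddChar.map_zero_eq_one]

/-- An involution is conjugate by an upper unitriangular matrix to a monomial matrix. -/
lemma exists_unitri_conj_eq_monomialMatrix (h2 : (2 : F) ≠ 0) {T : GL (Fin n) F}
    (hT : T * T = 1) :
    ∃ v ∈ unitri F n 0, ∃ (w : Equiv.Perm (Fin n)) (c : Fin n → F), (∀ i, c i ≠ 0) ∧
      ((v⁻¹ * T * v : GL (Fin n) F) : Matrix (Fin n) (Fin n) F) = monomialMatrix w c := by
  obtain ⟨u₁, hu₁, u₂, hu₂, w, c, hc, hN⟩ := exists_unitri_mul_mul_eq_monomialMatrix T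
  obtain ⟨N, hNdef⟩ : ∃ N, N = u₁ * T * u₂ := ⟨_, rfl⟩
  obtain ⟨u, hu⟩ : ∃ u, u = u₂⁻¹ * u₁⁻¹ := ⟨_, rfl⟩
  rw [← hNdef] at hN
  have hu_mem : u ∈ unitri F n 0 := hu ▸ mul_mem (inv_mem hu₂) (inv_mem hu₁)
  have hu_unitri : IsUnitri 0 u.1 := hu_mem
  have hNu : N * u = u₁ * T * u₁⁻¹ := by simp [hNdef, hu, mul_assoc]
  have hsq : N * u * (N * u) = 1 := by
    rw [hNu]
    calc u₁ * T * u₁⁻¹ * (u₁ * T * u₁⁻¹) = u₁ * (T * T) * u₁⁻¹ := by group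
      _ = 1 := by rw [hT]; group
  have hinv : u⁻¹ = N * (u * N) := by
    rw [eq_comm, eq_inv_iff_mul_eq_one, ← hsq]
    group
  have hentry : ∀ a b, (u⁻¹ : GL (Fin n) F).1 (w a) b = c a * (u.1 a (w b) * c b) := fun a b => by
    rw [hinv, GeneralLinearGroup.coe_mul, GeneralLinearGroup.coe_mul, hN,
      monomialMatrix_mul_apply, mul_monomialMatrix_apply]
  have hui : IsUnitri 0 (u⁻¹ : GL (Fin n) F).1 := inv_mem hu_mem
  have hww : ∀ b, w (w b) = b := apply_eq_of_forall_le (w.trans w) fun b => by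
    by_contra! hlt
    rw [Equiv.trans_apply] at hlt
    have h := hentry (w b) b
    rw [hui.lower _ _ hlt, hu_unitri.diag, one_mul] at h
    exact mul_ne_zero (hc _) (hc _) h.symm
  have hcc : ∀ b, c (w b) * c b = 1 := fun b => by
    have h := hentry (w b) b
    rw [hww, hui.diag, hu_unitri.diag, one_mul] at h
    exact h.symm
  have hNN : N * N = 1 := by
    ext i b
    obtain ⟨a, rfl⟩ := w.surjective i
    rw [GeneralLinearGroup.coe_mul, hN, monomialMatrix_mul_apply, monomialMatrix_apply,
      GeneralLinearGroup.coe_one]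
    split_ifs with h
    · rw [h, hcc, hww, one_apply_eq]
    · rw [one_apply_ne, mul_zero]
      rintro rfl
      exact h (hww a).symm
  have huNu : u * N * u = N := by
    rw [← mul_right_inj N, hNN, ← hsq]
    group
  have hv : IsUnitri 0 ((2 : F)⁻¹ • (1 + u.1)) := by
    refine ⟨fun i j hij => ?_, fun i => ?_, fun _ _ h => absurd h (Nat.not_lt_zero _)⟩
    · rw [Matrix.smul_apply, Matrix.add_apply, one_apply_ne hij.ne', hu_unitri.lower i j hij,
        add_zero, smul_zero]
    · rw [Matrix.smul_apply, Matrix.add_apply, one_apply_eq, hu_unitri.diag, one_add_one_eq_two,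
        smul_eq_mul, inv_mul_cancel₀ h2]
  have hcomm : hv.toGL * (N * u) = N * hv.toGL := by
    apply Units.ext
    have h := congrArg Units.val huNu
    simp only [GeneralLinearGroup.coe_mul, hv.coe_toGL] at h ⊢
    rw [smul_mul_assoc, mul_smul_comm, add_mul, one_mul, mul_add, mul_one, ← mul_assoc, h,
      add_comm]
  refine ⟨u₁⁻¹ * hv.toGL⁻¹, mul_mem (inv_mem hu₁) (inv_mem hv.toGL_mem), w, c, hc, ?_⟩
  rw [← hN]
  congr 1
  rw [← mul_left_inj hv.toGL, ← hcomm, hNu]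
  group

/-- A function on `GL_n`, left invariant under the centralizer of an involution `s` and
transforming on the right under the generic character, vanishes if it vanishes at those `g` for
which `g⁻¹ s g` is negated by the twisted antitranspose. -/
lemma eq_zero_of_centralizer_equivariant {ψ : AddChar F R} (hψ : ψ.IsPrimitive)
    (h2 : (2 : F) ≠ 0) (hn : Even n) {s : GL (Fin n) F} (hs : s * s = 1) {D : GL (Fin n) F → R}
    (hl : ∀ h g, h * s = s * h → D (h * g) = D g)
    (hr : ∀ u ∈ unitri F n 0, ∀ g, D (g * u) = genericChar ψ u * D g)
    (h0 : ∀ g : GL (Fin n) F, antiTranspose (-1) (g⁻¹ * s * g).1 = -(g⁻¹ * s * g).1 → D g = 0)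
    (g : GL (Fin n) F) : D g = 0 := by
  have hT : g⁻¹ * s * g * (g⁻¹ * s * g) = 1 := by
    calc g⁻¹ * s * g * (g⁻¹ * s * g) = g⁻¹ * (s * s) * g := by group
      _ = 1 := by rw [hs]; group
  obtain ⟨v, hv, w, c, hc, hN⟩ := exists_unitri_conj_eq_monomialMatrix h2 hT
  obtain ⟨k, hk⟩ : ∃ k, k = g * v := ⟨_, rfl⟩
  obtain ⟨N, hNdef⟩ : ∃ N, N = v⁻¹ * (g⁻¹ * s * g) * v := ⟨_, rfl⟩
  rw [← hNdef] at hN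
  have hkN : k⁻¹ * s * k = N := by rw [hk, hNdef]; group
  have hNN : N * N = 1 := by
    calc N * N = v⁻¹ * (g⁻¹ * s * g * (g⁻¹ * s * g)) * v := by rw [hNdef]; group
      _ = 1 := by rw [hT]; group
  suffices hD : D k = 0 by
    rw [show g = k * v⁻¹ by rw [hk]; group, hr _ (inv_mem hv), hD, mul_zero]
  by_cases hgood : ∀ i j : Fin n, (i : ℕ) + 1 = j → w i < w j →
      (w j : ℕ) = w i + 1 ∧ c j = -1 * c i
  · refine h0 k ?_
    rw [hkN, hN, antiTranspose_monomialMatrix (by ring) hgood]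
    rcases Nat.eq_zero_or_pos n with rfl | hpos
    · exact Matrix.ext fun i => i.elim0
    · rw [(Nat.Even.sub_odd hpos hn odd_one).neg_one_pow, neg_smul, one_smul]
  · push Not at hgood
    obtain ⟨i, j, hij, hw, hne⟩ := hgood
    have hlt : i < j := Fin.lt_def.2 (by omega)
    let t : F := superdiag F n 0 (w i) (w j) * (c i / c j)
    have ht : 1 + t ≠ 0 := by
      simp only [t, superdiag_zero_apply]
      split_ifs with h
      · have h' := hne h.symm
        intro h0
        refine h' ?_
        field_simp [hc j] at h0
        linear_combination h0
      · simp
    obtain ⟨x, hx⟩ := exists_apply_mul_ne_one hψ ht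
    obtain ⟨X, hX⟩ : ∃ X, X = Matrix.single i j x := ⟨_, rfl⟩
    obtain ⟨X', hX'⟩ : ∃ X', X' = Matrix.single (w i) (w j) (x * (c i / c j)) := ⟨_, rfl⟩
    have hu : IsUnitri 0 (1 + (X + X')) := isUnitri_one_add fun a b h => by
      rw [Matrix.add_apply, hX, hX', single_eq_zero_of_le hlt x h, single_eq_zero_of_le hw _ h, add_zero]
    have h1 : N.1 * X = X' * N.1 := by
      rw [hN, hX, hX', monomialMatrix_mul_single (hc j)]
    have hNN' : N.1 * N.1 = 1 := by
      rw [← GeneralLinearGroup.coe_mul, hNN, GeneralLinearGroup.coe_one]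
    have h3 : N.1 * X' = X * N.1 := by
      calc N.1 * X' = N.1 * (X' * N.1) * N.1 := by simp only [mul_assoc, hNN', mul_one]
        _ = X * N.1 := by rw [← h1, ← mul_assoc, hNN', one_mul]
    have hcomm : N * hu.toGL = hu.toGL * N := by
      apply Units.ext
      rw [GeneralLinearGroup.coe_mul, GeneralLinearGroup.coe_mul, hu.coe_toGL, mul_add, mul_add,
        add_mul, add_mul, h1, h3, mul_one, one_mul, add_comm (X' * _)]
    have hχ : genericChar ψ hu.toGL = ψ (x * (1 + t)) := by
      rw [genericChar, weightChar, hu.coe_toGL, weight_add_right, weight_add_right,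
        weight_superdiag_one, hX, hX', weight_single, weight_single, superdiag_zero_apply i j, if_pos hij]
      congr 1
      ring
    have hk1 : s * k = k * N := by rw [← hkN]; group
    have hk2 : k⁻¹ * s = N * k⁻¹ := by rw [← hkN]; group
    have h4 := hl (k * hu.toGL * k⁻¹) k (by
      calc k * hu.toGL * k⁻¹ * s = k * (hu.toGL * N) * k⁻¹ := by rw [mul_assoc, hk2]; group
        _ = s * (k * hu.toGL * k⁻¹) := by rw [← hcomm, ← mul_assoc k N, ← hk1]; group)
    rw [inv_mul_cancel_right, hr _ hu.toGL_mem, hχ] at h4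
    by_contra hD
    exact hx (mul_right_cancel₀ hD (h4.trans (one_mul _).symm))

end Equivariance

section SelfDual

variable {F : Type*} [Field F] {n : ℕ}

lemma antiTransposeInv_surjective {ε : F} (hε : ε * ε = 1) :
    Function.Surjective (antiTransposeInv (n := n) hε) :=
  fun g => ⟨_, antiTransposeInv_antiTransposeInv hε g⟩

lemma exists_antiTransposeInv_neg_one_eq_conj (h : (-1 : F) * -1 = 1) :
    ∃ a : GL (Fin n) F, ∀ g,
      antiTransposeInv h g = a * antiTransposeInv (mul_one (1 : F)) g * a⁻¹ := by
  have ha : diagonal (fun i : Fin n => (-1 : F) ^ (i : ℕ)) *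
      diagonal (fun i : Fin n => (-1 : F) ^ (i : ℕ)) = 1 := by
    rw [diagonal_mul_diagonal, ← diagonal_one]
    congr 1
    ext i
    rw [← pow_add, pow_add_self_eq_one h]
  refine ⟨⟨_, _, ha, ha⟩, fun g => eq_mul_inv_of_mul_eq (Units.ext ?_)⟩
  ext i j
  rw [GeneralLinearGroup.coe_mul, GeneralLinearGroup.coe_mul, mul_diagonal, diagonal_mul,
    coe_antiTransposeInv, coe_antiTransposeInv, antiTranspose_apply, antiTranspose_apply, one_pow,
    one_mul, pow_add, mul_right_comm, mul_assoc ((-1 : F) ^ (i : ℕ)), ← pow_add,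
    pow_add_self_eq_one h, mul_one]

variable [Finite F]

lemma genericChar_antiTransposeInv_one (ψ : AddChar F R) {u : GL (Fin n) F}
    (hu : u ∈ unitri F n 0) :
    genericChar ψ (antiTransposeInv (mul_one (1 : F)) u)⁻¹ = genericChar ψ u := by
  rw [← map_inv, genericChar, weightChar, weight_superdiag_antiTransposeInv _ (inv_mem hu),
    weight_superdiag_inv hu, neg_one_mul, neg_neg]
  rfl

lemma genericChar_antiTransposeInv_neg_one (ψ : AddChar F R) (h : (-1 : F) * -1 = 1)
    {u : GL (Fin n) F} (hu : u ∈ unitri F n 0) :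
    genericChar ψ (antiTransposeInv h u) = genericChar ψ u := by
  rw [genericChar, weightChar, weight_superdiag_antiTransposeInv _ hu, neg_neg, one_mul]
  rfl

variable {π : Representation R (GL (Fin n) F) V}

/-- The composite of the dual of a generic irreducible representation with the antitranspose
inverse is isomorphic to the representation. -/
lemma exists_equiv_dual_antiTransposeInv [FiniteDimensional R V] {ψ : AddChar F R} (hψ : ψ.IsPrimitive)
    (hirr : ∀ W : Submodule R V, (∀ g, ∀ v ∈ W, π g v ∈ W) → W = ⊥ ∨ W = ⊤)
    {w : V} (hw0 : w ≠ 0) (hw : ∀ u ∈ unitri F n 0, π u w = genericChar ψ u • w)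
    {l : Module.Dual R V} (hl0 : l ≠ 0)
    (hl : ∀ u ∈ unitri F n 0, ∀ v, l (π u v) = genericChar ψ u * l v) :
    ∃ e : V ≃ₗ[R] Module.Dual R V, ∀ g v,
      e (π g v) = π.dual (antiTransposeInv (mul_one (1 : F)) g) (e v) := by
  set τ := antiTransposeInv (n := n) (mul_one (1 : F)) with hτ
  have hτs : Function.Surjective τ := antiTransposeInv_surjective _
  refine exists_equiv_of_coeff_eq π (π.dual.comp τ) (w₁ := w) (w₂ := l) (l₁ := l)
    (l₂ := Module.Dual.eval R V w) (span_orbit_eq_top hirr hw0) ?_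
    (eq_zero_of_forall_coeff_eq_zero hirr hl0) ?_ ?_
  · rw [← span_dual_orbit_eq_top hirr hl0]
    exact congrArg _ (hτs.range_comp fun g => π.dual g l)
  · intro φ hφ
    have hle : Submodule.span R (Set.range fun g => π g w) ≤ LinearMap.ker φ := by
      rw [Submodule.span_le]
      rintro _ ⟨g, rfl⟩
      obtain ⟨g', hg'⟩ := hτs g⁻¹
      have h := hφ g'
      rw [MonoidHom.comp_apply, hg', Module.Dual.eval_apply, Representation.dual_apply, inv_inv] at h
      exact h
    rw [span_orbit_eq_top hirr hw0] at hle
    exact LinearMap.ext fun v => hle trivial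
  · intro g
    have key := eq_zero_of_biequivariant hψ (D := fun g => l (π g w) - l (π (τ g)⁻¹ w))
      (fun u hu g => by
        have hu' := inv_mem (antiTransposeInv_mem_unitri (mul_one (1 : F)) hu)
        rw [map_mul τ, _root_.mul_inv_rev, map_mul π, map_mul π, Module.End.mul_apply,
          Module.End.mul_apply, hl u hu, hw _ hu', map_smul, map_smul, smul_eq_mul,
          genericChar_antiTransposeInv_one ψ hu, mul_sub])
      (fun u hu g => by
        have hu' := inv_mem (antiTransposeInv_mem_unitri (mul_one (1 : F)) hu)
        rw [map_mul τ, _root_.mul_inv_rev, map_mul π, map_mul π, Module.End.mul_apply,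
          Module.End.mul_apply, hw u hu, hl _ hu', map_smul, map_smul, smul_eq_mul,
          genericChar_antiTransposeInv_one ψ hu, mul_sub])
      (fun g hg => by
        have : (τ g)⁻¹ = g := by
          rw [← map_inv]
          apply Units.ext
          rw [hτ, coe_antiTransposeInv, inv_inv, hg]
        rw [this, sub_self]) g
    exact sub_eq_zero.1 key

/-- A generic irreducible representation distinguished by the centralizer of a suitable involution
is isomorphic to its composite with the twisted antitranspose inverse. -/
lemma exists_equiv_antiTransposeInv_of_distinguished {ψ : AddChar F R} (hψ : ψ.IsPrimitive)
    (h2 : (2 : F) ≠ 0) (hn : Even n) {s : GL (Fin n) F} (hs : s * s = 1)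
    (hs' : antiTranspose (-1) s.1 = -s.1) (h : (-1 : F) * -1 = 1)
    (hirr : ∀ W : Submodule R V, (∀ g, ∀ v ∈ W, π g v ∈ W) → W = ⊥ ∨ W = ⊤)
    {w : V} (hw0 : w ≠ 0) (hw : ∀ u ∈ unitri F n 0, π u w = genericChar ψ u • w)
    {l : Module.Dual R V} (hl0 : l ≠ 0) (hl : ∀ h, h * s = s * h → ∀ v, l (π h v) = l v) :
    ∃ e : V ≃ₗ[R] V, ∀ g v, e (π g v) = π (antiTransposeInv h g) (e v) := by
  set σ := antiTransposeInv (n := n) h with hσ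
  have hσs : Function.Surjective σ := antiTransposeInv_surjective _
  have hinv : s⁻¹ = s := inv_eq_of_mul_eq_one_left hs
  have hσs' : (σ s).1 = -s.1 := by rw [hσ, coe_antiTransposeInv, hinv, hs']
  refine exists_equiv_of_coeff_eq π (π.comp σ) (w₁ := w) (w₂ := w) (l₁ := l) (l₂ := l)
    (span_orbit_eq_top hirr hw0) ?_ (eq_zero_of_forall_coeff_eq_zero hirr hl0) ?_ ?_
  · rw [← span_orbit_eq_top hirr hw0]
    exact congrArg _ (hσs.range_comp fun g => π g w)
  · refine fun v hv => eq_zero_of_forall_coeff_eq_zero hirr hl0 v fun g => ?_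
    obtain ⟨g', rfl⟩ := hσs g
    exact hv g'
  · intro g
    have key := eq_zero_of_centralizer_equivariant hψ h2 hn hs
      (D := fun g => l (π g w) - l (π (σ g) w))
      (fun x g hx => by
        have hx' : σ x * s = s * σ x := by
          have hc := congrArg (fun y => (σ y).1) hx
          simp only [map_mul, GeneralLinearGroup.coe_mul, hσs', mul_neg, neg_mul, neg_inj] at hc
          exact Units.ext hc
        rw [map_mul σ, map_mul π, map_mul π, Module.End.mul_apply, Module.End.mul_apply, hl x hx,
          hl _ hx'])
      (fun u hu g => by
        rw [map_mul σ, map_mul π, map_mul π, Module.End.mul_apply, Module.End.mul_apply, hw u hu,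
          hw _ (antiTransposeInv_mem_unitri h hu), map_smul, map_smul, map_smul, map_smul,
          smul_eq_mul, smul_eq_mul, genericChar_antiTransposeInv_neg_one ψ h hu, mul_sub])
      (fun g hg => by
        have h1 : (g⁻¹ * s * g)⁻¹ = g⁻¹ * s * g := by
          rw [_root_.mul_inv_rev, _root_.mul_inv_rev, inv_inv, hinv, mul_assoc]
        have h2 : (σ g)⁻¹ * s * σ g = g⁻¹ * s * g := by
          have h3 : (σ (g⁻¹ * s * g)).1 = -(g⁻¹ * s * g).1 := by
            rw [hσ, coe_antiTransposeInv, h1, hg]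
          rw [map_mul, map_mul, map_inv, GeneralLinearGroup.coe_mul, GeneralLinearGroup.coe_mul,
            hσs', mul_neg, neg_mul, neg_inj] at h3
          exact Units.ext h3
        have h4 : σ g * g⁻¹ * s = s * (σ g * g⁻¹) := by
          calc σ g * g⁻¹ * s = σ g * (g⁻¹ * s * g) * g⁻¹ := by group
            _ = s * (σ g * g⁻¹) := by rw [← h2]; group
        have h5 : σ g = σ g * g⁻¹ * g := by group
        rw [h5, map_mul π, Module.End.mul_apply, hl _ h4, sub_self]) g
    exact sub_eq_zero.1 key

/-- An irreducible cuspidal representation distinguished by the centralizer of a suitable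
involution is self-dual. -/
theorem exists_equiv_dual_of_distinguished [FiniteDimensional R V] [Nontrivial V]
    {ψ : AddChar F R} (hψ : ψ.IsPrimitive)
    (hchar : ringChar R ≠ ringChar F) (h2 : (2 : F) ≠ 0) (hn : Even n) {s : GL (Fin n) F}
    (hs : s * s = 1) (hs' : antiTranspose (-1) s.1 = -s.1)
    (hirr : ∀ W : Submodule R V, (∀ g, ∀ v ∈ W, π g v ∈ W) → W = ⊥ ∨ W = ⊤)
    (hcusp : IsCuspidalStandard π)
    {Λ : Module.Dual R V} (hΛ0 : Λ ≠ 0) (hΛ : ∀ h, h * s = s * h → ∀ v, Λ (π h v) = Λ v) :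
    ∃ e : V ≃ₗ[R] Module.Dual R V, ∀ g v, e (π g v) = π.dual g (e v) := by
  have h : (-1 : F) * -1 = 1 := by ring
  obtain ⟨w, hw0, hw⟩ := exists_whittaker_vector hψ hchar hcusp
  obtain ⟨l, hl0, hl⟩ := exists_whittaker_functional ψ hchar hw0 hw
  obtain ⟨eB, hB⟩ := exists_equiv_dual_antiTransposeInv hψ hirr hw0 hw hl0 hl
  obtain ⟨eA, hA⟩ :=
    exists_equiv_antiTransposeInv_of_distinguished hψ h2 hn hs hs' h hirr hw0 hw hΛ0 hΛ
  obtain ⟨a, ha⟩ := exists_antiTransposeInv_neg_one_eq_conj (n := n) h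
  set τ := antiTransposeInv (n := n) (mul_one (1 : F)) with hτ
  have hττ : ∀ g, τ (τ g) = g := antiTransposeInv_antiTransposeInv _
  let b : Module.Dual R V ≃ₗ[R] Module.Dual R V := LinearEquiv.ofLinearMap (π.dual (τ a)⁻¹)
    (π.dual (τ a)) (by rw [← Module.End.mul_eq_comp, ← map_mul, inv_mul_cancel, map_one]; rfl)
    (by rw [← Module.End.mul_eq_comp, ← map_mul, mul_inv_cancel, map_one]; rfl)
  have hb : ∀ φ, b φ = π.dual (τ a)⁻¹ φ := fun _ => rfl
  refine ⟨(eA.trans eB).trans b, fun g v => ?_⟩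
  have hg : (τ a)⁻¹ * τ (a * τ g * a⁻¹) = g * (τ a)⁻¹ := by
    rw [map_mul, map_mul, map_inv, hττ]
    group
  simp only [LinearEquiv.trans_apply]
  rw [hA, hB, hb, hb, ← Module.End.mul_apply, ← Module.End.mul_apply, ← map_mul, ← map_mul, ha, hg]

end SelfDual

section Transport

variable {F : Type*} [Field F]

/-- A nontrivial additive character of a finite field with values in an algebraically closed field
of different characteristic. -/
lemma exists_isPrimitive_addChar [Finite F] [IsAlgClosed R] (hchar : ringChar R ≠ ringChar F) :
    ∃ ψ : AddChar F R, ψ.IsPrimitive := by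
  let ψ := AddChar.FiniteField.primitiveChar F R hchar
  have : FiniteDimensional R (CyclotomicField ψ.n R) :=
    inferInstanceAs (FiniteDimensional R (Polynomial.cyclotomic ψ.n R).SplittingField)
  let f : CyclotomicField ψ.n R →ₐ[R] R := IsAlgClosed.lift
  exact ⟨(f : CyclotomicField ψ.n R →* R).compAddChar ψ.char,
    ψ.prim.compMulHom_of_isPrimitive f.injective⟩

/-- The identification of `GL_{m+m}` with matrices indexed by `Fin m ⊕ Fin m`. -/
def sumEquivGL (F : Type*) [Field F] (m : ℕ) : GL (Fin m ⊕ Fin m) F ≃* GL (Fin (m + m)) F :=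
  Units.mapEquiv (reindexAlgEquiv F F finSumFinEquiv).toMulEquiv

lemma sumEquivGL_apply (g : GL (Fin m ⊕ Fin m) F) (i j : Fin (m + m)) :
    (sumEquivGL F m g).1 i j = g.1 (finSumFinEquiv.symm i) (finSumFinEquiv.symm j) := rfl

lemma coe_sumEquivGL_blockDiagGL : (sumEquivGL F m (blockDiagGL 1 (-1))).1 =
    diagonal fun i : Fin (m + m) => if (i : ℕ) < m then 1 else -1 := by
  ext i j
  obtain ⟨x, rfl⟩ := finSumFinEquiv.surjective i
  obtain ⟨y, rfl⟩ := finSumFinEquiv.surjective j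
  rw [sumEquivGL_apply, Equiv.symm_apply_apply, Equiv.symm_apply_apply]
  rcases x with x | x <;> rcases y with y | y <;>
    simp [blockDiagGL, diagonal_apply, one_apply, Fin.ext_iff]
  · omega
  · omega
  · split_ifs <;> simp

lemma antiTranspose_sumEquivGL_blockDiagGL :
    antiTranspose (-1) (sumEquivGL F m (blockDiagGL 1 (-1))).1 =
      -(sumEquivGL F m (blockDiagGL 1 (-1))).1 := by
  rw [coe_sumEquivGL_blockDiagGL]
  ext i j
  rw [antiTranspose_apply, Matrix.neg_apply, diagonal_apply, diagonal_apply]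
  rcases eq_or_ne i j with rfl | h
  · rw [if_pos rfl, if_pos rfl, pow_add_self_eq_one (by ring), one_mul, Fin.val_rev]
    by_cases hi : (i : ℕ) < m
    · rw [if_pos hi, if_neg (by omega)]
    · rw [if_neg hi, if_pos (by omega), neg_neg]
  · rw [if_neg h, if_neg fun h' => h (Fin.rev_injective h').symm, mul_zero, neg_zero]

lemma fromBlocks_eq_of_commute (h2 : (2 : F) ≠ 0) {M : Matrix (Fin m ⊕ Fin m) (Fin m ⊕ Fin m) F}
    (h : M * fromBlocks 1 0 0 (-1) = fromBlocks 1 0 0 (-1) * M) :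
    M = fromBlocks M.toBlocks₁₁ 0 0 M.toBlocks₂₂ := by
  have key : ∀ a : F, -a = a → a = 0 := fun a ha => by
    have : (2 : F) * a = 0 := by linear_combination -ha
    exact (mul_eq_zero.1 this).resolve_left h2
  rw [← fromBlocks_toBlocks M, fromBlocks_multiply, fromBlocks_multiply, fromBlocks_inj] at h
  conv_lhs => rw [← fromBlocks_toBlocks M]
  congr 1
  · ext i j
    refine key _ ?_
    simpa using congrFun (congrFun h.2.1 i) j
  · ext i j
    refine key _ ?_
    simpa using (congrFun (congrFun h.2.2.1 i) j).symm

lemma exists_eq_blockDiagGL (h2 : (2 : F) ≠ 0) {h : GL (Fin m ⊕ Fin m) F}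
    (hh : Commute h (blockDiagGL 1 (-1))) : ∃ g₁ g₂, h = blockDiagGL g₁ g₂ := by
  have hs : (blockDiagGL 1 (-1) : GL (Fin m ⊕ Fin m) F).1 = fromBlocks 1 0 0 (-1) := rfl
  have h1 := fromBlocks_eq_of_commute h2 (by simpa [hs] using congrArg Units.val hh.eq)
  have h3 := fromBlocks_eq_of_commute h2 (M := (h⁻¹ : GL (Fin m ⊕ Fin m) F).1)
    (by rw [← hs]; exact congrArg Units.val hh.inv_left.eq)
  have h4 : h.1 * (h⁻¹ : GL (Fin m ⊕ Fin m) F).1 = 1 := Units.mul_inv h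
  have h5 : (h⁻¹ : GL (Fin m ⊕ Fin m) F).1 * h.1 = 1 := Units.inv_mul h
  rw [h1, h3, fromBlocks_multiply, ← fromBlocks_one, fromBlocks_inj] at h4 h5
  simp only [mul_zero, zero_mul, add_zero, zero_add] at h4 h5
  exact ⟨⟨_, _, h4.1, h5.1⟩, ⟨_, _, h4.2.2.2, h5.2.2.2⟩, Units.ext h1⟩

lemma UnipCond.sumEquivGL_mem_unipRadical [Finite F] {c : ℕ}
    {u : GL (Fin m ⊕ Fin m) F}
    (hu : UnipCond (fun i => if (finSumFinEquiv i : ℕ) < c then (0 : Fin 2) else 1) u) :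
    sumEquivGL F m u ∈ unipRadical F (m + m) c := by
  have hlow : ∀ i j : Fin (m + m), (j : ℕ) < c → c ≤ i → (sumEquivGL F m u).1 i j = 0 := by
    intro i j hj hi
    refine hu.1 _ _ ?_
    simp [hj, hi.not_gt]
  have hdiag : ∀ i j : Fin (m + m), ((i : ℕ) < c ↔ (j : ℕ) < c) →
      (sumEquivGL F m u).1 i j = if i = j then 1 else 0 := by
    intro i j hij
    rw [sumEquivGL_apply, hu.2 _ _ (by simp [hij])]
    simp
  rw [mem_unipRadical]
  refine ⟨⟨?_, ?_, ?_⟩, ?_⟩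
  · intro i j hij
    by_cases h : (i : ℕ) < c ↔ (j : ℕ) < c
    · rw [hdiag i j h, if_neg hij.ne']
    · exact hlow i j (by have : (j : ℕ) < i := hij; omega) (by have : (j : ℕ) < i := hij; omega)
  · intro i
    rw [hdiag i i Iff.rfl, if_pos rfl]
  · intro i j hj hij
    rw [hdiag i j (by have : (i : ℕ) < j := hij; omega), if_neg hij.ne]
  · intro i j hi hij
    rw [hdiag i j (by have : (i : ℕ) < j := hij; omega), if_neg hij.ne]

end Transport

/-- **Self-duality of cuspidal representations distinguished by the linear subgroup.**
For `q` odd and `R` algebraically closed of characteristic different from that of `𝒌`,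
an irreducible cuspidal representation of `GL_{2m}(𝒌)` distinguished by
`H = GL_m(𝒌) × GL_m(𝒌)` is self-dual. -/
theorem linear_distinguished_cuspidal_selfdual [IsAlgClosed R] [FiniteDimensional R V]
    (hq : Odd (Fintype.card k)) (hchar : ringChar R ≠ ringChar k)
    (π : Representation R (GL (Fin m ⊕ Fin m) k) V)
    (hV : ∃ v : V, v ≠ 0)
    (hirr : ∀ W : Submodule R V, (∀ (g : GL (Fin m ⊕ Fin m) k), ∀ v ∈ W, π g v ∈ W) →
      W = ⊥ ∨ W = ⊤)
    (hcusp : IsCuspidal π)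
    (hdist : ∃ Λ : Module.Dual R V, Λ ≠ 0 ∧
      ∀ (g₁ g₂ : GL (Fin m) k) (v : V), Λ (π (blockDiagGL g₁ g₂) v) = Λ v) :
    ∃ e : V ≃ₗ[R] Module.Dual R V, ∀ (g : GL (Fin m ⊕ Fin m) k) (v : V),
      e (π g v) = π.dual g (e v) := by
  have hVn : Nontrivial V := let ⟨v, hv⟩ := hV; ⟨⟨v, 0, hv⟩⟩
  have h2 : (2 : k) ≠ 0 := by
    refine Ring.two_ne_zero fun h => ?_
    exact (Nat.not_even_iff_odd.2 hq) (Nat.even_iff.2 (FiniteField.even_card_of_char_two h))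
  obtain ⟨ψ, hψ⟩ := exists_isPrimitive_addChar (R := R) hchar
  obtain ⟨Λ, hΛ0, hΛ⟩ := hdist
  let φ := sumEquivGL k m
  let π' : Representation R (GL (Fin (m + m)) k) V := π.comp φ.symm.toMonoidHom
  have hπ' : ∀ g, π' (φ g) = π g := fun g => congrArg π (φ.symm_apply_apply g)
  have hcusp' : IsCuspidalStandard π' := by
    intro c hc0 hc
    refine eq_top_iff.2 ((hcusp 2
      (fun i => if (finSumFinEquiv i : ℕ) < c then (0 : Fin 2) else 1)
      ⟨finSumFinEquiv.symm ⟨0, hc0.trans hc⟩, finSumFinEquiv.symm ⟨c, hc⟩, by simp [hc0]⟩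
      1).ge.trans (Submodule.span_mono ?_))
    rintro x ⟨u, hu, v, rfl⟩
    refine ⟨φ u, hu.sumEquivGL_mem_unipRadical, v, ?_⟩
    rw [hπ', one_mul, inv_one, mul_one]
  let s : GL (Fin m ⊕ Fin m) k := blockDiagGL 1 (-1)
  have hs : s * s = 1 := Units.ext (by simp [s, blockDiagGL, fromBlocks_multiply])
  obtain ⟨e, he⟩ := exists_equiv_dual_of_distinguished (π := π') hψ hchar h2 ⟨m, rfl⟩
    (s := φ s) (by rw [← map_mul, hs, map_one])
    antiTranspose_sumEquivGL_blockDiagGL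
    (fun W hW => hirr W fun g v hv => hπ' g ▸ hW (φ g) v hv) hcusp' hΛ0 (by
      intro h hh v
      obtain ⟨g, rfl⟩ := φ.surjective h
      obtain ⟨g₁, g₂, rfl⟩ := exists_eq_blockDiagGL h2 (h := g)
        (φ.injective (by rw [map_mul, map_mul, hh]))
      rw [hπ', hΛ])
  refine ⟨e, fun g v => ?_⟩
  rw [← hπ', he]
  refine LinearMap.ext fun w => ?_
  rw [Representation.dual_apply, Representation.dual_apply, ← map_inv, hπ']

end Stmt19
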